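/- arXiv:2005.12243 — 5 statements merged into one kernel-verified Lean document; each statement's English description precedes it below -/
import Mathlib

section
/- There exists an absolute constant C ≥ 1 such that for every integer d ≥ 2 and every integer n with n ≥ e^d · d · ln d, one has disp̃*(n, d) ≤ (C · ln d / n) · ln(n / ln d). -/
open MeasureTheory Set

noncomputable section

/-- The unit cube `Q_d = [0,1]^d`. -/
def cube (d : ℕ) : Set (Fin d → ℝ) := Set.univ.pi fun _ => Set.Icc (0 : ℝ) 1

/-- The periodic interval `I(s,t)`: `(s,t)` if `s < t`, and `[0,1] \ [t,s]` if `t < s`. -/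
def perInterval (s t : ℝ) : Set ℝ :=
  if s < t then Set.Ioo s t else Set.Icc 0 1 \ Set.Icc t s

/-- `B` is a periodic axis-parallel box in the unit cube. -/
def IsPerBox {d : ℕ} (B : Set (Fin d → ℝ)) : Prop :=
  ∃ a b : Fin d → ℝ, a ∈ cube d ∧ b ∈ cube d ∧ (∀ i, a i ≠ b i) ∧
    B = Set.univ.pi fun i => perInterval (a i) (b i)

/-- Periodic dispersion of a point set `P ⊆ Q_d`. -/
def pdisp {d : ℕ} (P : Set (Fin d → ℝ)) : ℝ :=
  sSup {v : ℝ | ∃ B : Set (Fin d → ℝ), IsPerBox B ∧ B ∩ P = ∅ ∧ v = (volume B).toReal}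

/-- Minimal periodic dispersion `disp̃*(n,d)`. -/
def pminDisp (n d : ℕ) : ℝ :=
  sInf {v : ℝ | ∃ P : Finset (Fin d → ℝ),
    ↑P ⊆ cube d ∧ P.card = n ∧ v = pdisp (↑P : Set (Fin d → ℝ))}

def Gset (c w : ℝ) : Set ℝ :=
  {x | x ∈ Set.Icc (0 : ℝ) 1 ∧ ((c < x ∧ x < c + w) ∨ (c < x + 1 ∧ x + 1 < c + w))}

lemma Gset_meas (c w : ℝ) : MeasurableSet (Gset c w) := by
  unfold Gset
  refine measurableSet_Icc.inter (MeasurableSet.union ?_ ?_)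
  · exact (measurableSet_lt measurable_const measurable_id).inter
      (measurableSet_lt measurable_id measurable_const)
  · exact (measurableSet_lt measurable_const (measurable_id.add_const 1)).inter
      (measurableSet_lt (measurable_id.add_const 1) measurable_const)

lemma Gset_sub (c w : ℝ) : Gset c w ⊆ Set.Icc 0 1 := fun _ h => h.1

lemma Gset_vol (c w : ℝ) (hc0 : 0 ≤ c) (hc1 : c ≤ 1) (hw0 : 0 ≤ w) (hw : w ≤ 1) :
    ENNReal.ofReal w ≤ volume (Gset c w) := by
  by_cases h : c + w ≤ 1
  · calc ENNReal.ofReal w = volume (Set.Ioo c (c + w)) := by rw [Real.volume_Ioo]; congr 1; ring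
      _ ≤ _ := by
          apply measure_mono
          intro x hx
          exact ⟨⟨by linarith [hx.1], by linarith [hx.2]⟩, Or.inl hx⟩
  · push Not at h
    have hd : Disjoint (Set.Ioo c 1) (Set.Ioo 0 (c + w - 1)) := by
      rw [Set.disjoint_left]
      intro x hx hy
      linarith [hx.1, hy.2]
    calc ENNReal.ofReal w = volume (Set.Ioo c 1 ∪ Set.Ioo 0 (c + w - 1)) := by
          rw [measure_union hd measurableSet_Ioo, Real.volume_Ioo, Real.volume_Ioo,
            ← ENNReal.ofReal_add (by linarith) (by linarith)]
          congr 1; ring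
      _ ≤ _ := by
          apply measure_mono
          rintro x (hx | hx)
          · exact ⟨⟨by linarith [hx.1], by linarith [hx.2]⟩, Or.inl ⟨hx.1, by linarith [hx.2]⟩⟩
          · exact ⟨⟨by linarith [hx.1], by linarith [hx.2]⟩,
              Or.inr ⟨by linarith [hx.1], by linarith [hx.2]⟩⟩

lemma per_sub {s t : ℝ} (hs : s ∈ Set.Icc (0 : ℝ) 1) (ht : t ∈ Set.Icc (0 : ℝ) 1) :
    perInterval s t ⊆ Set.Icc 0 1 := by
  unfold perInterval
  split_ifs
  · intro x hx
    exact ⟨by linarith [hx.1, hs.1], by linarith [hx.2, ht.2]⟩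
  · exact Set.diff_subset

lemma per_vol {s t : ℝ} (hs : s ∈ Set.Icc (0 : ℝ) 1) (ht : t ∈ Set.Icc (0 : ℝ) 1) :
    (volume (perInterval s t)).toReal = if s < t then t - s else t - s + 1 := by
  unfold perInterval
  split_ifs with h
  · rw [Real.volume_Ioo, ENNReal.toReal_ofReal (by linarith)]
  · push Not at h
    rw [measure_diff (Set.Icc_subset_Icc ht.1 hs.2) measurableSet_Icc.nullMeasurableSet
      (by simp), Real.volume_Icc, Real.volume_Icc, ← ENNReal.ofReal_sub _ (by linarith),
      ENNReal.toReal_ofReal (by linarith [hs.2, ht.1])]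
    ring

lemma Gset_sub_per {s t c w : ℝ} (hs : s ∈ Set.Icc (0 : ℝ) 1) (ht : t ∈ Set.Icc (0 : ℝ) 1)
    (hc : s ≤ c) (hw : c + w ≤ s + (volume (perInterval s t)).toReal) :
    Gset c w ⊆ perInterval s t := by
  rw [per_vol hs ht] at hw
  unfold perInterval
  rintro x ⟨⟨hx0, hx1⟩, hx⟩
  split_ifs at hw ⊢ with h
  · rcases hx with hx | hx
    · exact ⟨by linarith [hx.1], by linarith [hx.2]⟩
    · linarith [hx.2, ht.2]
  · refine ⟨⟨hx0, hx1⟩, ?_⟩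
    rintro ⟨h1, h2⟩
    rcases hx with hx | hx
    · linarith [hx.1]
    · linarith [hx.2]

/-- number of grid cells at scale `k` -/
def gm (d k : ℕ) : ℕ := ⌈(d : ℝ) * Real.exp (k / d)⌉₊

def gw (d k : ℕ) : ℝ := Real.exp (-(k / d : ℝ)) * (1 - 1 / d)

lemma one_dim (d k : ℕ) (hd : 2 ≤ d) {s t : ℝ} (hs : s ∈ Set.Icc (0 : ℝ) 1)
    (ht : t ∈ Set.Icc (0 : ℝ) 1)
    (hk : Real.exp (-(k / d : ℝ)) ≤ (volume (perInterval s t)).toReal) :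
    ∃ j : ℕ, j ∈ Finset.range (gm d k + 1) ∧
      Gset ((j : ℝ) / gm d k) (gw d k) ⊆ perInterval s t := by
  have hd' : (2 : ℝ) ≤ d := by exact_mod_cast hd
  have hE : 0 < Real.exp (k / d : ℝ) := Real.exp_pos _
  have hm : (d : ℝ) * Real.exp (k / d) ≤ gm d k := Nat.le_ceil _
  have hm0 : (0 : ℝ) < gm d k := lt_of_lt_of_le (by positivity) hm
  refine ⟨⌈s * gm d k⌉₊, ?_, ?_⟩
  · rw [Finset.mem_range, Nat.lt_succ_iff]
    apply Nat.ceil_le.2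
    nlinarith [hs.2]
  · apply Gset_sub_per hs ht
    · rw [le_div_iff₀ hm0]; exact Nat.le_ceil _
    · have h1 : (⌈s * gm d k⌉₊ : ℝ) / gm d k ≤ s + 1 / gm d k := by
        rw [div_le_iff₀ hm0, add_mul, one_div, inv_mul_cancel₀ hm0.ne']
        exact (Nat.ceil_lt_add_one (mul_nonneg hs.1 hm0.le)).le
      have h2 : 1 / (gm d k : ℝ) ≤ Real.exp (-(k / d : ℝ)) * (1 / d) := by
        calc 1 / (gm d k : ℝ) ≤ 1 / ((d : ℝ) * Real.exp (k / d)) :=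
              one_div_le_one_div_of_le (by positivity) hm
          _ = _ := by rw [Real.exp_neg]; field_simp
      unfold gw
      linarith

lemma gm_le (d k : ℕ) (hd : 2 ≤ d) :
    ((gm d k + 1 : ℕ) : ℝ) ≤ 2 * d * Real.exp (k / d) := by
  have hd' : (2 : ℝ) ≤ d := by exact_mod_cast hd
  have hE : 1 ≤ Real.exp (k / d : ℝ) := Real.one_le_exp (by positivity)
  have : (gm d k : ℝ) < (d : ℝ) * Real.exp (k / d) + 1 := Nat.ceil_lt_add_one (by positivity)
  push_cast
  nlinarith

lemma greedy {Ω ι : Type*} [MeasurableSpace Ω] [DecidableEq Ω] (μ : Measure Ω)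
    [IsProbabilityMeasure μ]
    (A : ι → Set Ω) (hA : ∀ i, MeasurableSet (A i)) (v : ℝ) (hv0 : 0 < v) (hv1 : v ≤ 1)
    (F : Finset ι) (hF : ∀ i ∈ F, v ≤ (μ (A i)).toReal) (n : ℕ) :
    ∃ P : Finset Ω, P.card ≤ n ∧ (∀ x ∈ P, ∃ i ∈ F, x ∈ A i) ∧
      ∃ F' : Finset ι, (∀ i ∈ F, i ∉ F' → ∃ x ∈ P, x ∈ A i) ∧ F' ⊆ F ∧
        (F'.card : ℝ) ≤ (1 - v) ^ n * F.card := by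
  classical
  induction n with
  | zero => exact ⟨∅, by simp, by simp, F, by simp, subset_rfl, by simp⟩
  | succ n ih =>
    obtain ⟨P, hP, hPA, F', hF', hsub, hcard⟩ := ih
    by_cases he : F' = ∅
    · refine ⟨P, by omega, hPA, F', hF', hsub, ?_⟩
      subst he
      simp only [Finset.card_empty, Nat.cast_zero]
      have : 0 ≤ 1 - v := by linarith
      positivity
    let f : Ω → ℝ := fun x => ∑ i ∈ F', (A i).indicator (fun _ => (1 : ℝ)) x
    have hint : ∀ i ∈ F', Integrable ((A i).indicator (fun _ => (1 : ℝ))) μ := fun i _ =>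
      (integrable_const _).indicator (hA i)
    have hf : Integrable f μ := integrable_finset_sum _ hint
    have hfi : v * F'.card ≤ ∫ x, f x ∂μ := by
      rw [integral_finset_sum _ hint]
      calc v * F'.card = ∑ i ∈ F', v := by simp [mul_comm]
        _ ≤ _ := by
          apply Finset.sum_le_sum
          intro i hi
          rw [integral_indicator (hA i)]
          simpa [Measure.real] using hF i (hsub hi)
    obtain ⟨x, hx⟩ := exists_integral_le hf
    have hfx : f x = ((F'.filter fun i => x ∈ A i).card : ℝ) := by
      simp [f, Set.indicator_apply, Finset.sum_boole]
    have hpos : 0 < v * F'.card := by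
      have : 0 < F'.card := Finset.card_pos.2 (Finset.nonempty_iff_ne_empty.2 he)
      positivity
    refine ⟨insert x P, (Finset.card_insert_le _ _).trans (by omega), ?_,
      F'.filter (fun i => ¬ x ∈ A i), ?_, (Finset.filter_subset _ _).trans hsub, ?_⟩
    · intro y hy
      rcases Finset.mem_insert.1 hy with rfl | hy
      · have : 0 < ((F'.filter fun i => y ∈ A i).card : ℝ) := by rw [← hfx]; linarith
        obtain ⟨i, hi⟩ := Finset.card_pos.1 (by exact_mod_cast this)
        rw [Finset.mem_filter] at hi
        exact ⟨i, hsub hi.1, hi.2⟩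
      · exact hPA y hy
    · intro i hi hni
      by_cases hx' : x ∈ A i
      · exact ⟨x, Finset.mem_insert_self _ _, hx'⟩
      · have : i ∉ F' := fun h => hni (Finset.mem_filter.2 ⟨h, hx'⟩)
        obtain ⟨y, hy, hyA⟩ := hF' i hi this
        exact ⟨y, Finset.mem_insert_of_mem hy, hyA⟩
    · have hsum : ((F'.filter fun i => x ∈ A i).card : ℝ)
          + ((F'.filter fun i => ¬ x ∈ A i).card : ℝ) = F'.card := by
        exact_mod_cast Finset.card_filter_add_card_filter_not (s := F') (fun i => x ∈ A i)
      have : ((F'.filter fun i => ¬ x ∈ A i).card : ℝ) ≤ (1 - v) * F'.card := by linarith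
      calc _ ≤ (1 - v) * F'.card := this
        _ ≤ (1 - v) * ((1 - v) ^ n * F.card) := by
          apply mul_le_mul_of_nonneg_left hcard; linarith
        _ = _ := by ring

abbrev Idx (d : ℕ) := Σ _ : Fin d → ℕ, Fin d → ℕ

def net (d S : ℕ) : Finset (Idx d) :=
  ((Fintype.piFinset fun _ : Fin d => Finset.range (S + 1)).filter fun k => ∑ i, k i ≤ S).sigma
    fun k => Fintype.piFinset fun i => Finset.range (gm d (k i) + 1)

def nbox (d : ℕ) (p : Idx d) : Set (Fin d → ℝ) :=
  Set.univ.pi fun i => Gset ((p.2 i : ℝ) / gm d (p.1 i)) (gw d (p.1 i))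

lemma net_card (d S : ℕ) (hd : 2 ≤ d) :
    ((net d S).card : ℝ) ≤ ((S : ℝ) + 1) ^ d * ((2 * d) ^ d * Real.exp (S / d)) := by
  have hd' : (2 : ℝ) ≤ d := by exact_mod_cast hd
  unfold net
  rw [Finset.card_sigma]
  push_cast
  set T := ((Fintype.piFinset fun _ : Fin d => Finset.range (S + 1)).filter
    fun k => ∑ i, k i ≤ S) with hT
  have h1 : ∀ k ∈ T, ((Fintype.piFinset fun i => Finset.range (gm d (k i) + 1)).card : ℝ)
      ≤ (2 * d) ^ d * Real.exp (S / d) := by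
    intro k hk
    have hk2 : ∑ i, k i ≤ S := (Finset.mem_filter.1 hk).2
    have hk3 : ∑ i, (k i : ℝ) ≤ S := by exact_mod_cast hk2
    rw [Fintype.card_piFinset]
    push_cast [Finset.card_range]
    calc ∏ i, ((gm d (k i) : ℝ) + 1) ≤ ∏ i, (2 * d * Real.exp ((k i : ℝ) / d)) := by
          apply Finset.prod_le_prod
          · intros; positivity
          · intro i _
            have := gm_le d (k i) hd
            push_cast at this
            exact this
      _ = (2 * d) ^ d * Real.exp ((∑ i, (k i : ℝ)) / d) := by
          rw [Finset.prod_mul_distrib, ← Real.exp_sum, Finset.sum_div]; simp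
      _ ≤ _ := by gcongr
  calc _ ≤ ∑ k ∈ T, (2 * d : ℝ) ^ d * Real.exp (S / d) := Finset.sum_le_sum h1
    _ = T.card * ((2 * d : ℝ) ^ d * Real.exp (S / d)) := by simp
    _ ≤ _ := by
      gcongr
      have : T.card ≤ (S + 1) ^ d := by
        refine (Finset.card_filter_le _ _).trans ?_
        simp
      exact_mod_cast this

lemma nbox_meas (d : ℕ) (p : Idx d) : MeasurableSet (nbox d p) :=
  MeasurableSet.univ_pi fun _ => Gset_meas _ _

lemma nbox_sub (d : ℕ) (p : Idx d) : nbox d p ⊆ cube d :=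
  Set.pi_mono fun _ _ => Gset_sub _ _

lemma cube_vol (d : ℕ) : volume (cube d) = 1 := by
  unfold cube
  rw [volume_pi_pi]; simp

lemma quarter (d : ℕ) (hd : 2 ≤ d) : (1 / 4 : ℝ) ≤ (1 - 1 / d) ^ d := by
  have hd' : (2 : ℝ) ≤ d := by exact_mod_cast hd
  have h0 : (0 : ℝ) < d := by linarith
  have hh : (1 : ℝ) / d ≤ 1 / 2 := one_div_le_one_div_of_le (by norm_num) hd'
  have h1 : (1 / 2 : ℝ) ≤ (1 - 1 / (d : ℝ)) ^ ((d : ℝ) / 2) := by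
    have := one_add_mul_self_le_rpow_one_add (s := -(1 / (d : ℝ))) (by linarith)
      (p := (d : ℝ) / 2) (by linarith)
    have e : 1 + (d : ℝ) / 2 * -(1 / (d : ℝ)) = 1 / 2 := by field_simp; ring
    rw [e] at this
    simpa [sub_eq_add_neg] using this
  have h2 : ((1 - 1 / (d : ℝ)) ^ ((d : ℝ) / 2)) ^ 2 = (1 - 1 / (d : ℝ)) ^ d := by
    rw [← Real.rpow_natCast, ← Real.rpow_mul (by linarith), ← Real.rpow_natCast]
    congr 1; push_cast; ring
  rw [← h2]; nlinarith

lemma nbox_vol (d S : ℕ) (hd : 2 ≤ d) (p : Idx d) (hp : p ∈ net d S) :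
    Real.exp (-(S / d : ℝ)) / 4 ≤ (volume (nbox d p)).toReal := by
  have hd' : (2 : ℝ) ≤ d := by exact_mod_cast hd
  have hh : (1 : ℝ) / d ≤ 1 / 2 := one_div_le_one_div_of_le (by norm_num) hd'
  have hi0 : (0 : ℝ) ≤ 1 / d := by positivity
  unfold net at hp
  rw [Finset.mem_sigma] at hp
  obtain ⟨hk, hj⟩ := hp
  have hk2 : ∑ i, p.1 i ≤ S := (Finset.mem_filter.1 hk).2
  have hk3 : ∑ i, (p.1 i : ℝ) ≤ S := by exact_mod_cast hk2
  rw [Fintype.mem_piFinset] at hj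
  unfold nbox
  rw [volume_pi_pi, ENNReal.toReal_prod]
  calc Real.exp (-(S / d : ℝ)) / 4 = Real.exp (-(S / d : ℝ)) * (1 / 4) := by ring
    _ ≤ Real.exp (-((∑ i, (p.1 i : ℝ)) / d)) * (1 - 1 / d) ^ d := by
      gcongr
      exact quarter d hd
    _ = ∏ i, gw d (p.1 i) := by
      unfold gw
      rw [Finset.prod_mul_distrib, ← Real.exp_sum, Finset.sum_div]; simp
    _ ≤ _ := by
      apply Finset.prod_le_prod
      · intro i _
        unfold gw
        exact mul_nonneg (Real.exp_pos _).le (by linarith)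
      · intro i _
        have hji := hj i
        rw [Finset.mem_range, Nat.lt_succ_iff] at hji
        have hw0 : 0 ≤ gw d (p.1 i) := mul_nonneg (Real.exp_pos _).le (by linarith)
        have hw1 : gw d (p.1 i) ≤ 1 := by
          unfold gw
          apply mul_le_one₀ _ (by linarith) (by linarith)
          apply Real.exp_le_one_iff.2
          have : (0 : ℝ) ≤ (p.1 i : ℝ) / d := by positivity
          linarith
        have := Gset_vol ((p.2 i : ℝ) / gm d (p.1 i)) (gw d (p.1 i)) (by positivity)
          (div_le_one_of_le₀ (by exact_mod_cast hji) (by positivity)) hw0 hw1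
        refine (ENNReal.ofReal_le_iff_le_toReal ?_).1 this
        exact ((measure_mono (Gset_sub _ _)).trans_lt (by simp)).ne

lemma perbox_sub {d : ℕ} {B : Set (Fin d → ℝ)} (hB : IsPerBox B) : B ⊆ cube d := by
  obtain ⟨a, b, ha, hb, -, rfl⟩ := hB
  exact Set.pi_mono fun i _ => per_sub (ha i trivial) (hb i trivial)

lemma perbox_vol_le {d : ℕ} {B : Set (Fin d → ℝ)} (hB : IsPerBox B) :
    (volume B).toReal ≤ 1 := by
  have := measure_mono (μ := volume) (perbox_sub hB)
  rw [cube_vol] at this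
  exact ENNReal.toReal_le_of_le_ofReal zero_le_one (by simpa using this)

lemma net_cover (d S : ℕ) (hd : 2 ≤ d) (L : ℝ) (hS : (d : ℝ) * (L + 1) < S + 1)
    {B : Set (Fin d → ℝ)} (hB : IsPerBox B) (hv : Real.exp (-L) ≤ (volume B).toReal) :
    ∃ p ∈ net d S, nbox d p ⊆ B := by
  have hd' : (2 : ℝ) ≤ d := by exact_mod_cast hd
  obtain ⟨a, b, ha, hb, -, rfl⟩ := hB
  set l : Fin d → ℝ := fun i => (volume (perInterval (a i) (b i))).toReal with hl
  have hvl : Real.exp (-L) ≤ ∏ i, l i := by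
    rw [volume_pi_pi, ENNReal.toReal_prod] at hv; exact hv
  have hl0 : ∀ i, 0 < l i := by
    intro i
    refine lt_of_le_of_ne ENNReal.toReal_nonneg ?_
    intro h
    rw [Finset.prod_eq_zero (Finset.mem_univ i) h.symm] at hvl
    linarith [Real.exp_pos (-L)]
  have hl1 : ∀ i, l i ≤ 1 := by
    intro i
    have := measure_mono (μ := volume) (per_sub (ha i trivial) (hb i trivial))
    exact ENNReal.toReal_le_of_le_ofReal zero_le_one (by simpa using this)
  have hsum : ∑ i, -Real.log (l i) ≤ L := by
    rw [Finset.sum_neg_distrib, ← Real.log_prod (fun i _ => (hl0 i).ne')]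
    have := Real.log_le_log (Real.exp_pos _) hvl
    rw [Real.log_exp] at this
    linarith
  have hlog : ∀ i, 0 ≤ -Real.log (l i) := fun i => by
    have := Real.log_nonpos (hl0 i).le (hl1 i)
    linarith
  let k : Fin d → ℕ := fun i => ⌈(d : ℝ) * -Real.log (l i)⌉₊
  have hk1 : ∀ i, Real.exp (-((k i : ℝ) / d)) ≤ l i := by
    intro i
    have h1 : (d : ℝ) * -Real.log (l i) ≤ k i := Nat.le_ceil _
    calc Real.exp (-((k i : ℝ) / d)) ≤ Real.exp (Real.log (l i)) := by
          apply Real.exp_le_exp.2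
          have : -Real.log (l i) ≤ (k i : ℝ) / d := by
            rw [le_div_iff₀ (by linarith)]; linarith
          linarith
      _ = l i := Real.exp_log (hl0 i)
  have hkS : ∑ i, k i ≤ S := by
    have h1 : ∑ i, (k i : ℝ) ≤ ∑ i, ((d : ℝ) * -Real.log (l i) + 1) := by
      apply Finset.sum_le_sum
      intro i _
      exact (Nat.ceil_lt_add_one (mul_nonneg (by positivity) (hlog i))).le
    rw [Finset.sum_add_distrib, ← Finset.mul_sum] at h1
    simp only [Finset.sum_const, Finset.card_univ, Fintype.card_fin, nsmul_eq_mul, mul_one] at h1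
    have h2 : ∑ i, (k i : ℝ) < S + 1 := by nlinarith
    have h3 : ∑ i, k i < S + 1 := by exact_mod_cast h2
    omega
  choose j hj hjs using fun i => one_dim d (k i) hd (ha i trivial) (hb i trivial) (hk1 i)
  refine ⟨⟨k, j⟩, ?_, ?_⟩
  · unfold net
    rw [Finset.mem_sigma]
    refine ⟨Finset.mem_filter.2 ⟨?_, hkS⟩, ?_⟩
    · rw [Fintype.mem_piFinset]
      intro i
      rw [Finset.mem_range, Nat.lt_succ_iff]
      exact (Finset.single_le_sum (fun _ _ => Nat.zero_le _) (Finset.mem_univ i)).trans hkS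
    · rw [Fintype.mem_piFinset]; exact hj
  · exact Set.pi_mono fun i _ => hjs i

lemma cube_inf (d : ℕ) (hd : 2 ≤ d) : (cube d).Infinite := by
  have : Nonempty (Fin d) := ⟨⟨0, by omega⟩⟩
  have : Function.Injective (fun (x : ℝ) (_ : Fin d) => x) := Function.const_injective
  refine (((Set.Icc_infinite (zero_lt_one' ℝ)).image this.injOn)).mono ?_
  rintro _ ⟨x, hx, rfl⟩ i _
  exact hx

lemma pmin_le (n d : ℕ) (hd : 2 ≤ d) (e : ℝ) (he : 0 ≤ e) (P : Finset (Fin d → ℝ))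
    (hP : (P : Set (Fin d → ℝ)) ⊆ cube d) (hn : P.card ≤ n)
    (h : ∀ B : Set (Fin d → ℝ), IsPerBox B → B ∩ P = ∅ → (volume B).toReal ≤ e) :
    pminDisp n d ≤ e := by
  obtain ⟨P', hPP', hP'c, hcard⟩ : ∃ P' : Finset (Fin d → ℝ), P ⊆ P' ∧
      (P' : Set (Fin d → ℝ)) ⊆ cube d ∧ P'.card = n := by
    classical
    have hinf : (cube d \ P).Infinite := (cube_inf d hd).diff P.finite_toSet
    obtain ⟨T, hT, hTc⟩ := hinf.exists_subset_card_eq (n - P.card)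
    refine ⟨P ∪ T, Finset.subset_union_left, ?_, ?_⟩
    · rw [Finset.coe_union]
      exact Set.union_subset hP (hT.trans Set.diff_subset)
    · rw [Finset.card_union_of_disjoint, hTc]
      · omega
      · rw [Finset.disjoint_left]
        intro x hx hxT
        exact (hT hxT).2 hx
  have h1 : pdisp (P' : Set (Fin d → ℝ)) ≤ e := by
    apply Real.sSup_le _ he
    rintro v ⟨B, hB, hBP, rfl⟩
    refine h B hB ?_
    apply Set.subset_eq_empty _ hBP
    exact Set.inter_subset_inter_right _ (by exact_mod_cast hPP')
  refine le_trans (csInf_le ⟨0, ?_⟩ ⟨P', hP'c, hcard, rfl⟩) h1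
  rintro v ⟨Q, -, -, rfl⟩
  apply Real.sSup_nonneg
  rintro v ⟨B, -, -, rfl⟩
  exact ENNReal.toReal_nonneg

lemma key (n d : ℕ) (hd : 2 ≤ d) (L : ℝ) (hL : 0 ≤ L)
    (h : d * Real.log (d * (L + 2)) + d * Real.log (2 * d) + (L + 1)
      < n * (Real.exp (-(L + 1)) / 4)) : pminDisp n d ≤ Real.exp (-L) := by
  classical
  have hd' : (2 : ℝ) ≤ d := by exact_mod_cast hd
  set S := ⌊(d : ℝ) * (L + 1)⌋₊ with hSdef
  have hS1 : (d : ℝ) * (L + 1) < S + 1 := Nat.lt_floor_add_one _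
  have hS2 : (S : ℝ) ≤ d * (L + 1) := Nat.floor_le (by positivity)
  have hS3 : (S : ℝ) / d ≤ L + 1 := by rw [div_le_iff₀ (by linarith)]; linarith
  set v := Real.exp (-(L + 1)) / 4 with hvdef
  have hv0 : 0 < v := by positivity
  have hv1 : v ≤ 1 := by
    have : Real.exp (-(L + 1)) ≤ 1 := Real.exp_le_one_iff.2 (by linarith)
    linarith
  let μ : Measure (Fin d → ℝ) := volume.restrict (cube d)
  have : IsProbabilityMeasure μ := ⟨by simp [μ, cube_vol]⟩
  have hvol : ∀ p ∈ net d S, v ≤ (μ (nbox d p)).toReal := by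
    intro p hp
    have h1 : μ (nbox d p) = volume (nbox d p) := by
      rw [Measure.restrict_apply (nbox_meas d p), Set.inter_eq_left.2 (nbox_sub d p)]
    rw [h1]
    refine le_trans ?_ (nbox_vol d S hd p hp)
    rw [hvdef]
    gcongr
  obtain ⟨P, hPn, hPA, F', hF', -, hcard⟩ :=
    greedy μ (nbox d) (nbox_meas d) v hv0 hv1 (net d S) hvol n
  have hc : ((net d S).card : ℝ) ≤ Real.exp (d * Real.log (d * (L + 2))
      + d * Real.log (2 * d) + (L + 1)) := by
    refine (net_card d S hd).trans ?_
    rw [Real.exp_add, Real.exp_add, mul_comm (d : ℝ) (Real.log _), mul_comm (d : ℝ) (Real.log _),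
      Real.exp_mul, Real.exp_mul, Real.exp_log (by positivity), Real.exp_log (by positivity),
      Real.rpow_natCast, Real.rpow_natCast, ← mul_assoc]
    gcongr
    nlinarith
  have hF0 : (F'.card : ℝ) < 1 := by
    calc (F'.card : ℝ) ≤ (1 - v) ^ n * (net d S).card := hcard
      _ ≤ (Real.exp (-v)) ^ n * Real.exp (d * Real.log (d * (L + 2))
            + d * Real.log (2 * d) + (L + 1)) := by
          gcongr
          linarith [Real.add_one_le_exp (-v)]
      _ = Real.exp (d * Real.log (d * (L + 2)) + d * Real.log (2 * d) + (L + 1) - n * v) := by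
          rw [← Real.exp_nat_mul, ← Real.exp_add]; congr 1; ring
      _ < 1 := by rw [Real.exp_lt_one_iff]; linarith
  have hFe : F' = ∅ := by
    have : F'.card < 1 := by exact_mod_cast hF0
    exact Finset.card_eq_zero.1 (by omega)
  refine pmin_le n d hd _ (Real.exp_pos _).le P ?_ hPn ?_
  · intro x hx
    obtain ⟨i, -, hi⟩ := hPA x hx
    exact nbox_sub d i hi
  · intro B hB hBP
    by_contra hlt
    push Not at hlt
    obtain ⟨p, hp, hpB⟩ := net_cover d S hd L hS1 hB hlt.le
    obtain ⟨x, hx, hxp⟩ := hF' p hp (by simp [hFe])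
    have : x ∈ B ∩ (P : Set (Fin d → ℝ)) := ⟨hpB hxp, hx⟩
    rw [hBP] at this
    exact this

/-- There exists an absolute constant `C ≥ 1` such that for every integer `d ≥ 2` and every
integer `n ≥ e^d · d · ln d`, one has `disp̃*(n,d) ≤ (C ln d / n) · ln(n / ln d)`. -/
theorem periodic_minimal_dispersion_bound_large_n :
    ∃ C : ℝ, 1 ≤ C ∧ ∀ d : ℕ, 2 ≤ d → ∀ n : ℕ,
      Real.exp d * d * Real.log d ≤ (n : ℝ) →
      pminDisp n d ≤ C * Real.log d / n * Real.log ((n : ℝ) / Real.log d) := by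
  refine ⟨110, by norm_num, ?_⟩
  intro d hd n hn
  have hd' : (2 : ℝ) ≤ d := by exact_mod_cast hd
  have hl2 := Real.log_two_gt_d9
  have hld : Real.log 2 ≤ Real.log d := Real.log_le_log (by norm_num) hd'
  set l := Real.log d with hl
  have hl0 : 0 < l := by linarith
  have hn0 : (0 : ℝ) < n := lt_of_lt_of_le (by positivity) hn
  set K := Real.log ((n : ℝ) / l) with hK
  have hM : Real.exp d ≤ (n : ℝ) / l := by
    rw [le_div_iff₀ hl0]
    refine le_trans ?_ hn
    have : 0 < Real.exp (d : ℝ) * l := by positivity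
    nlinarith
  have hKd : (d : ℝ) ≤ K := by
    have := Real.log_le_log (Real.exp_pos _) hM
    rwa [Real.log_exp] at this
  have hKexp : Real.exp K = n / l := Real.exp_log (by positivity)
  set e := 110 * l / n * K with he
  have he0 : 0 < e := by
    have : 0 < K := by linarith
    positivity
  by_cases he1 : 1 ≤ e
  · refine (pmin_le n d hd 1 zero_le_one ∅ (by simp) (by simp) ?_).trans he1
    intro B hB _
    exact perbox_vol_le hB
  push Not at he1
  have heL : Real.exp (-(-Real.log e)) = e := by rw [neg_neg, Real.exp_log he0]
  have hL0 : 0 ≤ -Real.log e := by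
    have := Real.log_nonpos he0.le he1.le
    linarith
  set L := -Real.log e with hLdef
  have heK : Real.exp (-K) ≤ e := by
    rw [Real.exp_neg, hKexp, inv_div, he]
    have : l / n * 1 ≤ l / n * (110 * K) := by
      apply mul_le_mul_of_nonneg_left _ (by positivity)
      linarith
    calc l / n ≤ l / n * (110 * K) := by linarith
      _ = _ := by ring
  have hLK : L ≤ K := by
    have := Real.log_le_log (Real.exp_pos _) heK
    rw [Real.log_exp] at this
    linarith
  have hne : n * e = 110 * l * K := by rw [he]; field_simp
  rw [← heL]
  apply key n d hd L hL0
  have hexp : Real.exp (-(L + 1)) = e * Real.exp (-1) := by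
    rw [← heL, ← Real.exp_add]; congr 1; ring
  have he11 : (1 : ℝ) / 2.75 ≤ Real.exp (-1) := by
    rw [Real.exp_neg, ← one_div]
    apply one_div_le_one_div_of_le (Real.exp_pos _)
    linarith [Real.exp_one_lt_d9]
  have hR : 10 * l * K ≤ n * (Real.exp (-(L + 1)) / 4) := by
    rw [hexp]
    have : n * (e * Real.exp (-1) / 4) = (110 * l * K) * Real.exp (-1) / 4 := by
      rw [← hne]; ring
    rw [this]
    have hlK : 0 < l * K := mul_pos hl0 (by linarith)
    have := mul_le_mul_of_nonneg_left he11 hlK.le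
    norm_num at this ⊢
    linarith
  refine lt_of_lt_of_le ?_ hR
  have h1 : Real.log (d * (L + 2)) = l + Real.log (L + 2) :=
    Real.log_mul (by linarith) (by linarith)
  have h2 : Real.log (2 * d) = Real.log 2 + l := Real.log_mul (by norm_num) (by linarith)
  have h3 : Real.log (L + 2) ≤ l + (K + 2) / d := by
    have h4 : L + 2 ≤ d * ((K + 2) / d) := by
      rw [mul_div_cancel₀]
      · linarith
      · linarith
    have hq : 0 < (K + 2) / d := div_pos (by linarith) (by linarith)
    have h5 := Real.log_le_log (by linarith) h4
    rw [Real.log_mul (by linarith) hq.ne'] at h5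
    have := Real.log_le_sub_one_of_pos hq
    linarith
  have h6 : d * Real.log (L + 2) ≤ d * l + (K + 2) := by
    have := mul_le_mul_of_nonneg_left h3 (by linarith : (0 : ℝ) ≤ d)
    have e2 : (d : ℝ) * (l + (K + 2) / d) = d * l + (K + 2) := by field_simp
    linarith
  rw [h1, h2]
  have h7 : d * l ≤ K * l := mul_le_mul_of_nonneg_right hKd hl0.le
  have h8 : d * Real.log 2 ≤ d * l := mul_le_mul_of_nonneg_left hld (by linarith)
  have h9 : K * 0.69 ≤ K * l := mul_le_mul_of_nonneg_left (by linarith) (by linarith)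
  norm_num at h9
  nlinarith
end
end

section
/- Let d ≥ 1 and ε, δ ∈ (0,1). If N is a δ-net for B_{ε,d} with |N| ≥ 3, then N(ε, d) ≤ 3 ln|N| / ((1−δ) ε). -/
open MeasureTheory Set

noncomputable section

/-- `B` is an axis-parallel box `∏ [aᵢ, bᵢ)` contained in the unit cube. -/
def IsBox {d : ℕ} (B : Set (Fin d → ℝ)) : Prop :=
  ∃ a b : Fin d → ℝ, (∀ i, 0 ≤ a i ∧ a i ≤ b i ∧ b i ≤ 1) ∧
    B = Set.univ.pi fun i => Set.Ico (a i) (b i)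

/-- Dispersion of a point set `P ⊆ Q_d`: the supremum of volumes of boxes avoiding `P`. -/
def disp {d : ℕ} (P : Set (Fin d → ℝ)) : ℝ :=
  sSup {v : ℝ | ∃ B : Set (Fin d → ℝ), IsBox B ∧ B ∩ P = ∅ ∧ v = (volume B).toReal}

/-- Minimal dispersion `disp*(n,d)` over all `n`-point subsets of the cube. -/
def minDisp (n d : ℕ) : ℝ :=
  sInf {v : ℝ | ∃ P : Finset (Fin d → ℝ),
    ↑P ⊆ cube d ∧ P.card = n ∧ v = disp (↑P : Set (Fin d → ℝ))}

/-- Inverse of the minimal dispersion, `N(ε,d)`. -/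
def Ninv (ε : ℝ) (d : ℕ) : ℕ := sInf {n : ℕ | minDisp n d ≤ ε}

/-- `F` is a `δ`-net for the family `B_{ε,d}` of boxes of volume at least `ε`. -/
def IsDeltaNet (δ ε : ℝ) (d : ℕ) (F : Finset (Set (Fin d → ℝ))) : Prop :=
  (∀ B ∈ F, IsBox B) ∧
  ∀ B : Set (Fin d → ℝ), IsBox B → ε ≤ (volume B).toReal →
    ∃ B₀ ∈ F, B₀ ⊆ B ∧ (1 - δ) * (volume B).toReal ≤ (volume B₀).toReal

lemma IsBox.subset_cube {d : ℕ} {B : Set (Fin d → ℝ)} (h : IsBox B) : B ⊆ cube d := by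
  obtain ⟨a, b, hab, rfl⟩ := h
  intro x hx i _
  have := hx i (Set.mem_univ i)
  exact ⟨(hab i).1.trans this.1, this.2.le.trans (hab i).2.2⟩

lemma IsBox.meas {d : ℕ} {B : Set (Fin d → ℝ)} (h : IsBox B) : MeasurableSet B := by
  obtain ⟨a, b, hab, rfl⟩ := h
  exact MeasurableSet.univ_pi fun i => measurableSet_Ico

open Classical in
lemma greedy_step {d : ℕ} (G : Finset (Set (Fin d → ℝ))) (hG : ∀ B ∈ G, IsBox B) (p : ℝ)
    (hp : ∀ B ∈ G, p ≤ (volume B).toReal) :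
    ∃ x : Fin d → ℝ, p * G.card ≤ ((G.filter fun B => x ∈ B).card : ℝ) := by
  let μ : Measure (Fin d → ℝ) := volume.restrict (cube d)
  haveI : IsProbabilityMeasure μ := ⟨by simp [μ, cube_vol]⟩
  let f : (Fin d → ℝ) → ℝ := fun x => ∑ B ∈ G, B.indicator (fun _ => (1 : ℝ)) x
  have hint : ∀ B ∈ G, Integrable (fun x => B.indicator (fun _ => (1 : ℝ)) x) μ := fun B hB =>
    (integrable_const (1 : ℝ)).indicator (hG B hB).meas
  have hf : Integrable f μ := integrable_finsetSum G hint
  obtain ⟨x, hx⟩ := exists_integral_le hf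
  refine ⟨x, ?_⟩
  have h1 : f x = ((G.filter fun B => x ∈ B).card : ℝ) := by
    simp [f, Set.indicator_apply]
  have h2 : ∫ x, f x ∂μ = ∑ B ∈ G, (volume B).toReal := by
    simp only [f]
    rw [integral_finsetSum G hint]
    refine Finset.sum_congr rfl fun B hB => ?_
    rw [integral_indicator (hG B hB).meas]
    simp [μ, Measure.real, Measure.restrict_apply (hG B hB).meas,
      Set.inter_eq_left.2 (hG B hB).subset_cube]
  rw [← h1]
  refine le_trans ?_ (h2 ▸ hx)
  have := Finset.card_nsmul_le_sum G (fun B => (volume B).toReal) p hp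
  rw [nsmul_eq_mul] at this
  linarith

open Classical in
lemma greedy_s10 {d : ℕ} (p : ℝ) (hp0 : 0 < p) (hp1 : p ≤ 1) (k : ℕ) :
    ∀ (G : Finset (Set (Fin d → ℝ))), (∀ B ∈ G, IsBox B) →
    (∀ B ∈ G, p ≤ (volume B).toReal) →
    ∃ P : Finset (Fin d → ℝ), (P : Set (Fin d → ℝ)) ⊆ cube d ∧ P.card ≤ k ∧
      ((G.filter fun B => B ∩ (P : Set (Fin d → ℝ)) = ∅).card : ℝ) ≤ (1 - p) ^ k * G.card := by
  induction k with
  | zero =>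
    intro G _ _
    exact ⟨∅, by simp, by simp, by simp⟩
  | succ k ih =>
    intro G hG hp
    rcases G.eq_empty_or_nonempty with rfl | hne
    · exact ⟨∅, by simp, by simp, by simp⟩
    obtain ⟨x, hx⟩ := greedy_step G hG p hp
    have hpos : (0 : ℝ) < G.card := by exact_mod_cast hne.card_pos
    have hxc : x ∈ cube d := by
      have h0 : (0 : ℝ) < ((G.filter fun B => x ∈ B).card : ℝ) := lt_of_lt_of_le (by positivity) hx
      obtain ⟨B, hB⟩ := Finset.card_pos.1 (by exact_mod_cast h0)
      rw [Finset.mem_filter] at hB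
      exact (hG B hB.1).subset_cube hB.2
    have hsplit := Finset.card_filter_add_card_filter_not (s := G) (fun B => x ∈ B)
    have hsplit' : ((G.filter fun B => x ∈ B).card : ℝ) + ((G.filter fun B => x ∉ B).card : ℝ)
      = G.card := by exact_mod_cast hsplit
    obtain ⟨P, hP, hPk, hPG⟩ := ih (G.filter fun B => x ∉ B)
      (fun B hB => hG B (Finset.mem_filter.1 hB).1) (fun B hB => hp B (Finset.mem_filter.1 hB).1)
    refine ⟨insert x P, ?_, (Finset.card_insert_le _ _).trans (by omega), ?_⟩
    · rw [Finset.coe_insert]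
      exact Set.insert_subset hxc hP
    · have h1 : (G.filter fun B => B ∩ ((insert x P : Finset (Fin d → ℝ)) : Set (Fin d → ℝ)) = ∅)
          ⊆ (G.filter fun B => x ∉ B).filter fun B => B ∩ (P : Set (Fin d → ℝ)) = ∅ := by
        intro B hB
        rw [Finset.mem_filter] at hB
        obtain ⟨hB, he⟩ := hB
        rw [Finset.mem_filter, Finset.mem_filter]
        refine ⟨⟨hB, fun hxB => ?_⟩, ?_⟩
        · have : x ∈ B ∩ ((insert x P : Finset (Fin d → ℝ)) : Set (Fin d → ℝ)) := ⟨hxB, by simp⟩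
          rw [he] at this
          exact this
        · refine Set.subset_empty_iff.1 (he ▸ Set.inter_subset_inter_right B ?_)
          simp
      have h2 : ((G.filter fun B => B ∩ ((insert x P : Finset (Fin d → ℝ)) :
          Set (Fin d → ℝ)) = ∅).card : ℝ) ≤
          (((G.filter fun B => x ∉ B).filter fun B => B ∩ (P : Set (Fin d → ℝ)) = ∅).card : ℝ) := by
        exact_mod_cast Finset.card_le_card h1
      refine h2.trans (hPG.trans ?_)
      rw [pow_succ, mul_assoc]
      have : 0 ≤ (1 - p) ^ k := pow_nonneg (by linarith) k
      refine mul_le_mul_of_nonneg_left ?_ this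
      linarith

/-- If `N` is a `δ`-net for `B_{ε,d}` with `|N| ≥ 3`, then `N(ε,d) ≤ 3 ln|N| / ((1-δ)ε)`. -/
theorem Ninv_le_of_deltaNet (d : ℕ) (hd : 1 ≤ d) (ε δ : ℝ)
    (hε0 : 0 < ε) (hε1 : ε < 1) (hδ0 : 0 < δ) (hδ1 : δ < 1)
    (F : Finset (Set (Fin d → ℝ))) (hF : IsDeltaNet δ ε d F) (hcard : 3 ≤ F.card) :
    (Ninv ε d : ℝ) ≤ 3 * Real.log F.card / ((1 - δ) * ε) := by
  classical
  set p := (1 - δ) * ε with hpdef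
  have hp0 : 0 < p := mul_pos (by linarith) hε0
  have hp1 : p < 1 := by nlinarith
  set L := Real.log F.card with hL
  have hc3 : (3 : ℝ) ≤ F.card := by exact_mod_cast hcard
  have hL1 : 1 ≤ L := by
    rw [hL, Real.le_log_iff_exp_le (by linarith)]
    linarith [Real.exp_one_lt_d9]
  set k := ⌊L / p⌋₊ + 1 with hk
  have hk1 : L / p < k := by
    rw [hk, Nat.cast_add, Nat.cast_one]; exact Nat.lt_floor_add_one _
  have hk2 : (k : ℝ) ≤ L / p + 1 := by
    rw [hk, Nat.cast_add, Nat.cast_one]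
    linarith [Nat.floor_le (show 0 ≤ L / p from div_nonneg (by linarith) hp0.le)]
  have h1 : 1 ≤ L / p := by
    rw [le_div_iff₀ hp0]; linarith
  obtain ⟨P, hP, hPk, hPG⟩ := greedy_s10 p hp0 hp1.le k
    (F.filter fun B => p ≤ (volume B).toReal)
    (fun B hB => hF.1 B (Finset.mem_filter.1 hB).1) (fun B hB => (Finset.mem_filter.1 hB).2)
  have hlt : (1 - p) ^ k * ((F.filter fun B => p ≤ (volume B).toReal).card : ℝ) < 1 := by
    have hle : ((F.filter fun B => p ≤ (volume B).toReal).card : ℝ) ≤ F.card := by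
      exact_mod_cast Finset.card_filter_le _ _
    have hpow : (1 - p) ^ k ≤ Real.exp (-(k * p)) := by
      have h := pow_le_pow_left₀ (by linarith : 0 ≤ 1 - p) (Real.one_sub_le_exp_neg p) k
      rw [← Real.exp_nat_mul] at h
      simpa using h
    have hFe : (F.card : ℝ) = Real.exp L := by rw [hL, Real.exp_log (by linarith)]
    calc _ ≤ Real.exp (-(k * p)) * F.card :=
          mul_le_mul hpow hle (Nat.cast_nonneg _) (Real.exp_pos _).le
      _ = Real.exp (-(k * p) + L) := by rw [hFe, Real.exp_add]
      _ < 1 := by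
        rw [Real.exp_lt_one_iff]
        rw [div_lt_iff₀ hp0] at hk1
        linarith
  have hemp : (F.filter fun B => p ≤ (volume B).toReal).filter
      (fun B => B ∩ (P : Set (Fin d → ℝ)) = ∅) = ∅ := by
    rw [← Finset.card_eq_zero]
    have := hPG.trans_lt hlt
    have : ((F.filter fun B => p ≤ (volume B).toReal).filter
      (fun B => B ∩ (P : Set (Fin d → ℝ)) = ∅)).card < 1 := by exact_mod_cast this
    omega
  have hdisp : disp (P : Set (Fin d → ℝ)) ≤ ε := by
    refine Real.sSup_le ?_ hε0.le
    rintro v ⟨B, hB, hBP, rfl⟩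
    by_contra! hv
    obtain ⟨B₀, hB₀, hsub, hvol⟩ := hF.2 B hB hv.le
    have : B₀ ∈ (F.filter fun B => p ≤ (volume B).toReal).filter
      (fun B => B ∩ (P : Set (Fin d → ℝ)) = ∅) := by
      rw [Finset.mem_filter, Finset.mem_filter]
      refine ⟨⟨hB₀, ?_⟩, ?_⟩
      · exact (mul_le_mul_of_nonneg_left hv.le (by linarith)).trans hvol
      · exact Set.subset_empty_iff.1 (hBP ▸ Set.inter_subset_inter_left _ hsub)
    rw [hemp] at this
    simp at this
  have hmin : minDisp P.card d ≤ ε := by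
    refine le_trans (csInf_le ⟨0, ?_⟩ ⟨P, hP, rfl, rfl⟩) hdisp
    rintro v ⟨Q, -, -, rfl⟩
    refine Real.sSup_nonneg ?_
    rintro v ⟨B, -, -, rfl⟩
    exact ENNReal.toReal_nonneg
  have hN : Ninv ε d ≤ k := (Nat.sInf_le hmin).trans hPk
  have hN' : (Ninv ε d : ℝ) ≤ k := by exact_mod_cast hN
  have : 3 * L / p = 3 * (L / p) := by ring
  rw [this]
  linarith
end
end

section
/- Let m ≥ 2 be an integer and ε ∈ (0,1). Then there exists a (1/2)-net N for B_{ε,m} with |N| ≤ (14m)^{4m} / ε^{2·log₂(2m)}. -/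
open MeasureTheory Set

noncomputable section

lemma one_dim_net (N : ℕ) (hN : 8 ≤ N) (a b : ℝ) (ha : 0 ≤ a) (hab : a < b) (hb : b ≤ 1) :
    ∃ (k : ℕ) (p : ℕ × ℕ), p.1 ≤ 2 ^ k * N ∧ p.2 ≤ N ∧ (b - a) * 2 ^ k ≤ 1 ∧
      a ≤ p.1 / (2 ^ k * N : ℝ) ∧ (p.1 + p.2) / (2 ^ k * N : ℝ) ≤ b ∧
      (b - a) * (1 - 4 / N) ≤ p.2 / (2 ^ k * N : ℝ) := by
  obtain ⟨k, hk1, hk2⟩ := exists_nat_pow_near_of_lt_one (x := b - a) (y := (1/2 : ℝ))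
    (by linarith) (by linarith) (by norm_num) (by norm_num)
  have hN' : (8 : ℝ) ≤ N := by exact_mod_cast hN
  have h2k : (0 : ℝ) < 2 ^ k := by positivity
  have e1 : ((1:ℝ)/2) ^ k * 2 ^ k = 1 := by rw [← mul_pow]; norm_num
  have u1 : (b - a) * 2 ^ k ≤ 1 := by
    calc _ ≤ ((1:ℝ)/2) ^ k * 2 ^ k := by gcongr
      _ = 1 := e1
  have u2 : 1 < 2 * ((b - a) * 2 ^ k) := by
    have : ((1:ℝ)/2) ^ (k+1) * 2 ^ k < (b - a) * 2 ^ k := by gcongr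
    rw [pow_succ] at this
    nlinarith
  set M : ℝ := 2 ^ k * N with hM
  have hMpos : 0 < M := by positivity
  have v1 : (b - a) * M ≤ N := by
    calc (b - a) * M = ((b - a) * 2 ^ k) * N := by rw [hM]; ring
      _ ≤ 1 * N := by gcongr
      _ = N := one_mul _
  have v2 : (N : ℝ) ≤ 2 * ((b - a) * M) := by
    calc (N : ℝ) = 1 * N := (one_mul _).symm
      _ ≤ (2 * ((b - a) * 2 ^ k)) * N := by gcongr
      _ = _ := by rw [hM]; ring
  have hb0 : 0 ≤ b := by linarith
  have c1 := Nat.le_ceil (a * M)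
  have c2 := Nat.ceil_lt_add_one (show 0 ≤ a * M by positivity)
  have f1 := Nat.floor_le (show 0 ≤ b * M by positivity)
  have f2 := Nat.lt_floor_add_one (b * M)
  set i := ⌈a * M⌉₊
  set j := ⌊b * M⌋₊
  have hij : i ≤ j := by
    have : (i : ℝ) ≤ j := by nlinarith
    exact_mod_cast this
  obtain ⟨t, ht⟩ := Nat.exists_eq_add_of_le hij
  have ht' : (j : ℝ) = i + t := by exact_mod_cast ht
  refine ⟨k, (i, t), ?_, ?_, u1, ?_, ?_, ?_⟩
  · have : (i : ℝ) ≤ 2 ^ k * N := by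
      have : (i : ℝ) ≤ j := by exact_mod_cast hij
      nlinarith
    exact_mod_cast this
  · have : (t : ℝ) ≤ N := by nlinarith
    exact_mod_cast this
  · rw [le_div_iff₀ hMpos]; exact c1
  · rw [div_le_iff₀ hMpos]; simp only; linarith
  · rw [le_div_iff₀ hMpos]
    simp only
    have : (b - a) * (4 / N) * M ≥ 2 := by
      have : (b - a) * (4 / N) * M = 4 * ((b - a) * M) / N := by ring
      rw [this, ge_iff_le, le_div_iff₀ (by linarith)]
      linarith
    nlinarith

def netBox (m N : ℕ) (k : Fin m → ℕ) (p : Fin m → ℕ × ℕ) : Set (Fin m → ℝ) :=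
  Set.univ.pi fun i => Set.Ico ((p i).1 / (2 ^ (k i) * N : ℝ))
    (((p i).1 + (p i).2) / (2 ^ (k i) * N : ℝ))

open Classical in
theorem exists_half_net_aux (m : ℕ) (hm : 2 ≤ m) (ε : ℝ) (hε0 : 0 < ε) :
    ∃ F : Finset (Set (Fin m → ℝ)), IsDeltaNet (1 / 2) ε m F ∧
      (F.card : ℝ) ≤ 2 ^ m * (8 * m + 1 : ℝ) ^ (2 * m) / ε ^ 2 := by
  set N := 8 * m with hN
  set K := ⌈1 / ε⌉₊
  let S : Finset (Fin m → ℕ) := (Fintype.piFinset fun _ => Finset.range (K + 1)).filter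
    (fun k => ε * ∏ i, (2 : ℝ) ^ (k i) ≤ 1)
  let P : (Fin m → ℕ) → Finset (Fin m → ℕ × ℕ) := fun k =>
    Fintype.piFinset fun i => Finset.range (2 ^ (k i) * N + 1) ×ˢ Finset.range (N + 1)
  let F := (S.biUnion fun k => (P k).image (netBox m N k)).filter IsBox
  refine ⟨F, ⟨fun B hB => (Finset.mem_filter.1 hB).2, ?_⟩, ?_⟩
  · rintro B ⟨a, b, hab, rfl⟩ hvol
    rw [Real.volume_pi_Ico_toReal (fun i => (hab i).2.1)] at *
    have hlt : ∀ i, a i < b i := by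
      intro i
      refine lt_of_le_of_ne (hab i).2.1 fun h => ?_
      have : ∏ i, (b i - a i) = 0 := Finset.prod_eq_zero (Finset.mem_univ i) (by rw [h]; ring)
      linarith
    choose k p h1 h2 h3 h4 h5 h6 using fun i =>
      one_dim_net N (by omega) (a i) (b i) (hab i).1 (hlt i) (hab i).2.2
    have hNpos : (0 : ℝ) < N := by rw [hN]; positivity
    have hle : ∀ i, ((p i).1 / (2 ^ (k i) * N : ℝ)) ≤
        (((p i).1 + (p i).2) / (2 ^ (k i) * N : ℝ)) := by
      intro i
      gcongr
      simp
    have hprod : ε * ∏ i, (2 : ℝ) ^ (k i) ≤ 1 := by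
      calc ε * ∏ i, (2 : ℝ) ^ (k i) ≤ (∏ i, (b i - a i)) * ∏ i, (2 : ℝ) ^ (k i) := by gcongr
        _ = ∏ i, ((b i - a i) * 2 ^ (k i)) := Finset.prod_mul_distrib.symm
        _ ≤ 1 := Finset.prod_le_one
          (fun i _ => mul_nonneg (by linarith [hlt i]) (by positivity)) (fun i _ => h3 i)
    refine ⟨netBox m N k p, ?_, ?_, ?_⟩
    · refine Finset.mem_filter.2 ⟨Finset.mem_biUnion.2 ⟨k, ?_, Finset.mem_image_of_mem _ ?_⟩, ?_⟩
      · refine Finset.mem_filter.2 ⟨Fintype.mem_piFinset.2 fun i => ?_, hprod⟩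
        rw [Finset.mem_range, Nat.lt_succ_iff]
        have q1 : (2 : ℝ) ^ (k i) ≤ ∏ i, (2 : ℝ) ^ (k i) := by
          rw [Finset.prod_pow_eq_pow_sum]
          exact pow_le_pow_right₀ (by norm_num)
            (Finset.single_le_sum (f := k) (fun _ _ => Nat.zero_le _) (Finset.mem_univ i))
        have q2 : ∏ i, (2 : ℝ) ^ (k i) ≤ 1 / ε := by
          rw [le_div_iff₀ hε0]; linarith
        have q3 : (k i : ℝ) < 2 ^ (k i) := by exact_mod_cast (k i).lt_two_pow_self
        have q4 : 1 / ε ≤ K := Nat.le_ceil _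
        have : (k i : ℝ) ≤ K := by linarith
        exact_mod_cast this
      · refine Fintype.mem_piFinset.2 fun i => ?_
        rw [Finset.mem_product, Finset.mem_range, Finset.mem_range]
        exact ⟨Nat.lt_succ_of_le (h1 i), Nat.lt_succ_of_le (h2 i)⟩
      · exact ⟨_, _, fun i => ⟨by positivity, hle i, (h5 i).trans (hab i).2.2⟩, rfl⟩
    · exact Set.pi_mono fun i _ => Set.Ico_subset_Ico (h4 i) (h5 i)
    · rw [netBox, Real.volume_pi_Ico_toReal hle]
      have hber : (1 : ℝ) - 1 / 2 ≤ (1 - 4 / N) ^ m := by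
        have hm' : (2 : ℝ) ≤ m := by exact_mod_cast hm
        have e : (4 : ℝ) / N = 1 / (2 * m) := by
          rw [hN]; push_cast; field_simp; norm_num
        have h14 : (1 : ℝ) / (2 * m) ≤ 1 := by
          rw [div_le_one (by positivity)]; linarith
        have := one_add_mul_le_pow (a := -(4 / (N:ℝ))) (by rw [e]; linarith) m
        rw [← sub_eq_add_neg] at this
        refine le_trans (le_of_eq ?_) this
        rw [e]; field_simp; norm_num
      have h4N : (4 : ℝ) / N ≤ 1 := by
        rw [div_le_one hNpos]
        have : 4 ≤ N := by omega
        exact_mod_cast this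
      calc (1 - 1 / 2) * ∏ i, (b i - a i) ≤ (1 - 4 / N : ℝ) ^ m * ∏ i, (b i - a i) := by
            gcongr
            exact Finset.prod_nonneg fun i _ => by linarith [hlt i]
        _ = ∏ i, ((b i - a i) * (1 - 4 / N : ℝ)) := by
            rw [Finset.prod_mul_distrib]; simp; ring
        _ ≤ _ := by
            refine Finset.prod_le_prod (fun i _ => mul_nonneg (by linarith [hlt i]) (by linarith))
              fun i _ => ?_
            refine (h6 i).trans (le_of_eq ?_)
            ring
  · have hc : F.card ≤ ∑ k ∈ S, (P k).card :=
      (Finset.card_filter_le _ _).trans (Finset.card_biUnion_le.trans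
        (Finset.sum_le_sum fun k _ => Finset.card_image_le))
    have hP : ∀ k ∈ S, ((P k).card : ℝ) ≤
        (N + 1 : ℝ) ^ (2 * m) / ε ^ 2 * ∏ i, ((1 : ℝ) / 2) ^ (k i) := by
      intro k hk
      have hk2 := (Finset.mem_filter.1 hk).2
      set T := ∏ i, (2 : ℝ) ^ (k i)
      have hT : 0 < T := Finset.prod_pos fun i _ => by positivity
      have eT : ∏ i, ((1 : ℝ) / 2) ^ (k i) = 1 / T := by
        simp [T]
      have : ((P k).card : ℝ) = ∏ i, ((2 ^ (k i) * N + 1 : ℝ) * (N + 1)) := by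
        simp [P, Fintype.card_piFinset]
      rw [this, eT]
      calc ∏ i, ((2 ^ (k i) * N + 1 : ℝ) * (N + 1))
          ≤ ∏ i, ((2 : ℝ) ^ (k i) * (N + 1 : ℝ) ^ 2) := by
            refine Finset.prod_le_prod (fun i _ => by positivity) fun i _ => ?_
            have : (1 : ℝ) ≤ 2 ^ (k i) := one_le_pow₀ (by norm_num)
            have : (2 ^ (k i) * N + 1 : ℝ) ≤ 2 ^ (k i) * (N + 1) := by linarith
            calc _ ≤ (2 ^ (k i) * (N + 1) : ℝ) * (N + 1) := by gcongr
              _ = _ := by ring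
        _ = T * (N + 1 : ℝ) ^ (2 * m) := by
            rw [Finset.prod_mul_distrib]; simp [T, pow_mul]
        _ ≤ _ := by
            have : T ≤ 1 / ε ^ 2 * (1 / T) := by
              rw [div_mul_div_comm, le_div_iff₀ (by positivity)]
              have : (ε * T) ^ 2 ≤ 1 := pow_le_one₀ (by positivity) hk2
              linarith
            calc _ ≤ (1 / ε ^ 2 * (1 / T)) * (N + 1 : ℝ) ^ (2 * m) := by gcongr
              _ = _ := by ring
    have hS : ∑ k ∈ S, ∏ i, ((1 : ℝ) / 2) ^ (k i) ≤ 2 ^ m := by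
      calc ∑ k ∈ S, ∏ i, ((1 : ℝ) / 2) ^ (k i)
          ≤ ∑ k ∈ Fintype.piFinset fun _ : Fin m => Finset.range (K + 1),
              ∏ i, ((1 : ℝ) / 2) ^ (k i) :=
            Finset.sum_le_sum_of_subset_of_nonneg (Finset.filter_subset _ _)
              fun _ _ _ => Finset.prod_nonneg fun _ _ => by positivity
        _ = ∏ _i : Fin m, ∑ n ∈ Finset.range (K + 1), ((1 : ℝ) / 2) ^ n :=
            (Finset.prod_univ_sum _ (fun _ n => ((1 : ℝ) / 2) ^ n)).symm
        _ = (∑ n ∈ Finset.range (K + 1), ((1 : ℝ) / 2) ^ n) ^ m := by simp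
        _ ≤ 2 ^ m := by
            gcongr
            exact sum_geometric_two_le _
    calc (F.card : ℝ) ≤ ∑ k ∈ S, ((P k).card : ℝ) := by exact_mod_cast hc
      _ ≤ ∑ k ∈ S, (N + 1 : ℝ) ^ (2 * m) / ε ^ 2 * ∏ i, ((1 : ℝ) / 2) ^ (k i) :=
          Finset.sum_le_sum hP
      _ = (N + 1 : ℝ) ^ (2 * m) / ε ^ 2 * ∑ k ∈ S, ∏ i, ((1 : ℝ) / 2) ^ (k i) :=
          (Finset.mul_sum _ _ _).symm
      _ ≤ (N + 1 : ℝ) ^ (2 * m) / ε ^ 2 * 2 ^ m := by gcongr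
      _ = _ := by rw [hN]; push_cast; ring

/-- For every integer `m ≥ 2` and `ε ∈ (0,1)` there exists a `(1/2)`-net for `B_{ε,m}` of
cardinality at most `(14m)^{4m} / ε^{2 log₂(2m)}`. -/
theorem exists_half_net (m : ℕ) (hm : 2 ≤ m) (ε : ℝ) (hε0 : 0 < ε) (hε1 : ε < 1) :
    ∃ F : Finset (Set (Fin m → ℝ)), IsDeltaNet (1 / 2) ε m F ∧
      (F.card : ℝ) ≤ (14 * (m : ℝ)) ^ (4 * m) / ε ^ (2 * Real.logb 2 (2 * (m : ℝ))) := by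
  obtain ⟨F, hF, hc⟩ := exists_half_net_aux m hm ε hε0
  refine ⟨F, hF, hc.trans ?_⟩
  have hm' : (2 : ℝ) ≤ m := by exact_mod_cast hm
  have hlog : (1 : ℝ) ≤ Real.logb 2 (2 * (m : ℝ)) := by
    rw [Real.le_logb_iff_rpow_le (by norm_num) (by positivity), Real.rpow_one]
    linarith
  have hpow : ε ^ (2 * Real.logb 2 (2 * (m : ℝ))) ≤ ε ^ 2 := by
    rw [← Real.rpow_natCast]
    exact Real.rpow_le_rpow_of_exponent_ge hε0 hε1.le (by push_cast; linarith)
  have hnum : (2 : ℝ) ^ m * (8 * m + 1 : ℝ) ^ (2 * m) ≤ (14 * (m : ℝ)) ^ (4 * m) := by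
    rw [pow_mul, pow_mul, ← mul_pow]
    gcongr
    have h1 : (8 * m + 1 : ℝ) ^ 2 ≤ (14 * m) ^ 2 := by gcongr; linarith
    have h2 : (2 : ℝ) ≤ (14 * m) ^ 2 := by nlinarith
    calc (2 : ℝ) * (8 * m + 1 : ℝ) ^ 2 ≤ (14 * m) ^ 2 * (14 * m) ^ 2 := by gcongr
      _ = _ := by ring
  gcongr
end
end

section
/- Let m ≥ 2 be an integer and ε ∈ (0,1). Then there exists a (1/2)-net Ñ for the family B̃_{ε,m} of periodic boxes of volume at least ε with |Ñ| ≤ (14m)^{4m} / ε^{2·log₂(2m)}. -/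
open MeasureTheory Set

noncomputable section

/-- `F` is a `δ`-net for the family `B̃_{ε,d}` of periodic boxes of volume at least `ε`. -/
def IsPerDeltaNet (δ ε : ℝ) (d : ℕ) (F : Finset (Set (Fin d → ℝ))) : Prop :=
  (∀ B ∈ F, IsPerBox B) ∧
  ∀ B : Set (Fin d → ℝ), IsPerBox B → ε ≤ (volume B).toReal →
    ∃ B₀ ∈ F, B₀ ⊆ B ∧ (1 - δ) * (volume B).toReal ≤ (volume B₀).toReal

lemma perInterval_volume (a b : ℝ) (ha : a ∈ Set.Icc (0:ℝ) 1) (hb : b ∈ Set.Icc (0:ℝ) 1)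
    (hab : a ≠ b) :
    (volume (perInterval a b)).toReal = if a < b then b - a else 1 - (a - b) := by
  unfold perInterval
  split_ifs with h
  · rw [Real.volume_Ioo, ENNReal.toReal_ofReal (by linarith)]
  · have hba : b < a := lt_of_le_of_ne (not_lt.1 h) (Ne.symm hab)
    rw [measure_sdiff (Set.Icc_subset_Icc hb.1 ha.2) measurableSet_Icc.nullMeasurableSet
      (by simp [Real.volume_Icc])]
    rw [Real.volume_Icc, Real.volume_Icc, ← ENNReal.ofReal_sub _ (by linarith),
      ENNReal.toReal_ofReal (by linarith [hb.1, ha.2])]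
    ring

lemma perInterval_round (G : ℕ) (hG : 0 < G) (a b : ℝ) (ha : a ∈ Set.Icc (0:ℝ) 1)
    (hb : b ∈ Set.Icc (0:ℝ) 1) (hab : a ≠ b)
    (hl : 2 / (G:ℝ) < (volume (perInterval a b)).toReal) :
    ∃ i ∈ Finset.range (G+1), ∃ j ∈ Finset.range (G+1), i ≠ j ∧
      perInterval ((i:ℝ)/G) ((j:ℝ)/G) ⊆ perInterval a b ∧
      (volume (perInterval a b)).toReal - 2 / (G:ℝ) ≤
        (volume (perInterval ((i:ℝ)/G) ((j:ℝ)/G))).toReal := by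
  have hG' : (0:ℝ) < G := by exact_mod_cast hG
  set i := ⌈a * G⌉₊ with hi
  set j := ⌊b * G⌋₊ with hj
  have h0a : 0 ≤ a * G := mul_nonneg ha.1 hG'.le
  have h0b : 0 ≤ b * G := mul_nonneg hb.1 hG'.le
  have hiG : i ≤ G := Nat.ceil_le.2 (by nlinarith [ha.2])
  have hjG : j ≤ G := by
    have := Nat.floor_le h0b
    have h2 : (j:ℝ) ≤ G := this.trans (by nlinarith [hb.2])
    exact_mod_cast h2
  have i1 : a ≤ (i:ℝ)/G := by rw [le_div_iff₀ hG']; exact Nat.le_ceil _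
  have i2 : (i:ℝ)/G < a + 1/G := by
    rw [div_lt_iff₀ hG', add_mul, div_mul_cancel₀ _ hG'.ne']; exact Nat.ceil_lt_add_one h0a
  have j1 : (j:ℝ)/G ≤ b := by rw [div_le_iff₀ hG']; exact Nat.floor_le h0b
  have j2 : b - 1/G < (j:ℝ)/G := by
    rw [lt_div_iff₀ hG', sub_mul, div_mul_cancel₀ _ hG'.ne']
    have := Nat.lt_floor_add_one (b * G)
    linarith
  have i3 : (i:ℝ)/G ≤ 1 := by rw [div_le_one hG']; exact_mod_cast hiG
  have j3 : (0:ℝ) ≤ (j:ℝ)/G := by positivity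
  have e2 : 2 / (G:ℝ) = 1/G + 1/G := by ring
  have hgp : (0:ℝ) < 1/G := by positivity
  have hmi : (i:ℝ)/G ∈ Set.Icc (0:ℝ) 1 := ⟨ha.1.trans i1, i3⟩
  have hmj : (j:ℝ)/G ∈ Set.Icc (0:ℝ) 1 := ⟨j3, j1.trans hb.2⟩
  rw [e2] at hl ⊢
  rw [perInterval_volume a b ha hb hab] at hl ⊢
  rcases lt_or_gt_of_ne hab with h | h
  · rw [if_pos h] at hl ⊢
    have hlt : (i:ℝ)/G < (j:ℝ)/G := by linarith
    refine ⟨i, by simp; omega, j, by simp; omega, ?_, ?_, ?_⟩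
    · rintro e; rw [e] at hlt; exact lt_irrefl _ hlt
    · unfold perInterval; rw [if_pos h, if_pos hlt]; exact Set.Ioo_subset_Ioo i1 j1
    · rw [perInterval_volume _ _ hmi hmj hlt.ne, if_pos hlt]; linarith
  · rw [if_neg (not_lt.2 h.le)] at hl ⊢
    have hlt : (j:ℝ)/G < (i:ℝ)/G := by linarith
    refine ⟨i, by simp; omega, j, by simp; omega, ?_, ?_, ?_⟩
    · rintro e; rw [e] at hlt; exact lt_irrefl _ hlt
    · unfold perInterval; rw [if_neg (not_lt.2 h.le), if_neg (not_lt.2 hlt.le)]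
      exact Set.sdiff_subset_sdiff_right (Set.Icc_subset_Icc j1 i1)
    · rw [perInterval_volume _ _ hmi hmj hlt.ne', if_neg (not_lt.2 hlt.le)]; linarith

def gridSize (m k : ℕ) : ℕ := 8 * m * 2 ^ k

def gridPairs (m k : ℕ) : Finset (ℕ × ℕ) :=
  (Finset.range (gridSize m k + 1) ×ˢ Finset.range (gridSize m k + 1)).filter fun p => p.1 ≠ p.2

def gridBox (m : ℕ) (k : Fin m → ℕ) (p : Fin m → ℕ × ℕ) : Set (Fin m → ℝ) :=
  Set.univ.pi fun i =>
    perInterval (((p i).1 : ℝ) / gridSize m (k i)) (((p i).2 : ℝ) / gridSize m (k i))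

lemma coord_approx (m : ℕ) (hm : 2 ≤ m) (a b : ℝ) (ha : a ∈ Set.Icc (0:ℝ) 1)
    (hb : b ∈ Set.Icc (0:ℝ) 1) (hab : a ≠ b) (hl : 0 < (volume (perInterval a b)).toReal) :
    ∃ k : ℕ, ∃ p ∈ gridPairs m k, (2:ℝ)^k * (volume (perInterval a b)).toReal ≤ 1 ∧
      perInterval ((p.1:ℝ)/gridSize m k) ((p.2:ℝ)/gridSize m k) ⊆ perInterval a b ∧
      (1 - 1/(2*(m:ℝ))) * (volume (perInterval a b)).toReal ≤
        (volume (perInterval ((p.1:ℝ)/gridSize m k) ((p.2:ℝ)/gridSize m k))).toReal := by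
  have hm' : (2:ℝ) ≤ m := by exact_mod_cast hm
  have hl1 : (volume (perInterval a b)).toReal ≤ 1 := by
    rw [perInterval_volume a b ha hb hab]
    split_ifs with h
    · linarith [ha.1, hb.2]
    · linarith [not_lt.1 h]
  set l := (volume (perInterval a b)).toReal with hldef
  obtain ⟨k, hk1, hk2⟩ := exists_nat_pow_near (one_le_inv₀ hl |>.2 hl1) (one_lt_two (α := ℝ))
  have hk1' : (2:ℝ)^k * l ≤ 1 := by
    have := mul_le_mul_of_nonneg_right hk1 hl.le
    rwa [inv_mul_cancel₀ hl.ne'] at this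
  have hk2' : 1 < (2:ℝ)^(k+1) * l := by
    have := mul_lt_mul_of_pos_right hk2 hl
    rwa [inv_mul_cancel₀ hl.ne'] at this
  have hGpos : 0 < gridSize m k := by unfold gridSize; positivity
  have hp : (0:ℝ) < 2^k := by positivity
  have hstep : 2 / (gridSize m k : ℝ) ≤ 1/(2*(m:ℝ)) * l := by
    unfold gridSize
    push_cast
    rw [div_le_iff₀ (by positivity)]
    have : 1 / (2*(m:ℝ)) * l * (8 * m * 2^k) = 2 * ((2:ℝ)^(k+1) * l) := by
      field_simp; ring
    rw [this]; linarith
  have h14 : 1/(2*(m:ℝ)) ≤ 1/4 := by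
    apply one_div_le_one_div_of_le <;> linarith
  obtain ⟨i, hi, j, hj, hij, hs, hv⟩ := perInterval_round (gridSize m k) hGpos a b ha hb hab
    (by rw [← hldef]; nlinarith)
  refine ⟨k, (i,j), ?_, hk1', hs, ?_⟩
  · simp only [gridPairs, Finset.mem_filter, Finset.mem_product]; exact ⟨⟨hi, hj⟩, hij⟩
  · refine le_trans ?_ hv
    rw [← hldef]; linarith

lemma gridPairs_card (m k : ℕ) (hm : 2 ≤ m) :
    ((gridPairs m k).card : ℝ) ≤ 81 * (m:ℝ)^2 * 4^k := by
  have h1 : (gridPairs m k).card ≤ (gridSize m k + 1) * (gridSize m k + 1) := by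
    refine (Finset.card_filter_le _ _).trans ?_
    simp
  have h2 : gridSize m k + 1 ≤ 9 * m * 2^k := by
    unfold gridSize
    have : 1 ≤ m * 2^k := Nat.mul_pos (by omega) (by positivity)
    nlinarith
  have h3 : (gridPairs m k).card ≤ (9 * m * 2^k) * (9 * m * 2^k) :=
    h1.trans (Nat.mul_le_mul h2 h2)
  have h4 : ((gridPairs m k).card : ℝ) ≤ (9 * m * 2^k) * (9 * m * 2^k) := by exact_mod_cast h3
  refine h4.trans (le_of_eq ?_)
  have : (4:ℝ)^k = 2^k * 2^k := by rw [← mul_pow]; norm_num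
  rw [this]; ring

lemma geom_half (K : ℕ) : ∑ k ∈ Finset.range K, ((1:ℝ)/2)^k ≤ 2 := by
  have := geom_sum_eq (x := (1:ℝ)/2) (by norm_num) K
  rw [this]
  have : (0:ℝ) < (1/2)^K := by positivity
  rw [div_le_iff_of_neg (by norm_num)]
  linarith

open Classical in
def netK (m : ℕ) (ε : ℝ) : Finset (Fin m → ℕ) :=
  (Fintype.piFinset fun _ : Fin m => Finset.range (⌊1/ε⌋₊ + 1)).filter
    fun k => (∏ i, (2:ℝ)^(k i)) * ε ≤ 1

open Classical in
def netF (m : ℕ) (ε : ℝ) : Finset (Set (Fin m → ℝ)) :=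
  (netK m ε).biUnion fun k => (Fintype.piFinset fun i => gridPairs m (k i)).image (gridBox m k)

lemma term_bound (m : ℕ) (hm : 2 ≤ m) (ε : ℝ) (hε0 : 0 < ε) (k : Fin m → ℕ)
    (hk' : (∏ i, (2:ℝ)^(k i)) * ε ≤ 1) :
    ∏ i, ((gridPairs m (k i)).card : ℝ) ≤ (∏ i, (81 * (m:ℝ)^2 * (1/2)^(k i))) / ε^3 := by
  rw [le_div_iff₀ (pow_pos hε0 3)]
  have a1 : ∏ i, ((gridPairs m (k i)).card : ℝ) ≤ ∏ i, (81 * (m:ℝ)^2 * 4^(k i)) :=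
    Finset.prod_le_prod (fun _ _ => Nat.cast_nonneg _) fun i _ => gridPairs_card m (k i) hm
  have a2 : ∏ i, (81 * (m:ℝ)^2 * 4^(k i)) =
      (∏ i, (81 * (m:ℝ)^2 * (1/2)^(k i))) * (∏ i, (2:ℝ)^(k i))^3 := by
    rw [← Finset.prod_pow, ← Finset.prod_mul_distrib]
    refine Finset.prod_congr rfl fun i _ => ?_
    rw [mul_assoc _ (((1:ℝ)/2)^(k i)), ← pow_mul, mul_comm (k i) 3, pow_mul, ← mul_pow]
    norm_num
  have a3 : ((∏ i, (2:ℝ)^(k i)) * ε)^3 ≤ 1 := pow_le_one₀ (by positivity) hk'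
  have a4 : 0 ≤ ∏ i, (81 * (m:ℝ)^2 * (1/2)^(k i)) :=
    Finset.prod_nonneg fun i _ => by positivity
  calc _ ≤ (∏ i, (81 * (m:ℝ)^2 * 4^(k i))) * ε^3 :=
        mul_le_mul_of_nonneg_right a1 (pow_pos hε0 3).le
    _ = (∏ i, (81 * (m:ℝ)^2 * (1/2)^(k i))) * ((∏ i, (2:ℝ)^(k i)) * ε)^3 := by
        rw [a2, mul_pow, mul_assoc]
    _ ≤ _ := mul_le_of_le_one_right a4 a3

lemma full_sum (m K : ℕ) (c : ℝ) (hc : 0 ≤ c) :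
    ∑ k ∈ Fintype.piFinset fun _ : Fin m => Finset.range K, ∏ i, (c * (1/2)^(k i)) ≤
      (c * 2)^m := by
  have e := (Finset.prod_univ_sum (fun _ : Fin m => Finset.range K)
    (fun _ k => c * (1/2:ℝ)^k)).symm
  rw [e, Finset.prod_const, Finset.card_univ, Fintype.card_fin, ← Finset.mul_sum]
  have h := geom_half K
  have h0 : 0 ≤ ∑ k ∈ Finset.range K, ((1:ℝ)/2)^k := Finset.sum_nonneg fun _ _ => by positivity
  exact pow_le_pow_left₀ (mul_nonneg hc h0) (mul_le_mul_of_nonneg_left h hc) m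

lemma netF_card (m : ℕ) (hm : 2 ≤ m) (ε : ℝ) (hε0 : 0 < ε) :
    ((netF m ε).card : ℝ) ≤ (81 * (m:ℝ)^2 * 2)^m / ε^3 := by
  classical
  have h1 : (netF m ε).card ≤ ∑ k ∈ netK m ε, ∏ i, (gridPairs m (k i)).card := by
    unfold netF
    refine Finset.card_biUnion_le.trans (Finset.sum_le_sum fun k _ => ?_)
    refine Finset.card_image_le.trans ?_
    rw [Fintype.card_piFinset]
  have h2 : ((netF m ε).card : ℝ) ≤ ∑ k ∈ netK m ε, ∏ i, ((gridPairs m (k i)).card : ℝ) := by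
    exact_mod_cast h1
  have h3 : ∑ k ∈ netK m ε, ∏ i, ((gridPairs m (k i)).card : ℝ) ≤
      ∑ k ∈ netK m ε, (∏ i, (81 * (m:ℝ)^2 * (1/2)^(k i))) / ε^3 :=
    Finset.sum_le_sum fun k hk => term_bound m hm ε hε0 k (Finset.mem_filter.1 hk).2
  refine h2.trans (h3.trans ?_)
  rw [← Finset.sum_div]
  refine div_le_div_of_nonneg_right ?_ (pow_pos hε0 3).le
  refine le_trans (Finset.sum_le_sum_of_subset_of_nonneg (Finset.filter_subset _ _)
    fun k _ _ => Finset.prod_nonneg fun i _ => ?_) (full_sum m _ _ ?_)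
  · positivity
  · positivity

lemma vol_box (m : ℕ) (I : Fin m → Set ℝ) :
    (volume (Set.univ.pi I)).toReal = ∏ i, (volume (I i)).toReal := by
  rw [volume_pi_pi, ENNReal.toReal_prod]

lemma netF_net (m : ℕ) (hm : 2 ≤ m) (ε : ℝ) (hε0 : 0 < ε) :
    IsPerDeltaNet (1 / 2) ε m (netF m ε) := by
  classical
  have hm' : (2:ℝ) ≤ m := by exact_mod_cast hm
  constructor
  · intro B hB
    simp only [netF, Finset.mem_biUnion, Finset.mem_image, Fintype.mem_piFinset, gridPairs,
      Finset.mem_filter, Finset.mem_product, Finset.mem_range] at hB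
    obtain ⟨k, -, p, hp, rfl⟩ := hB
    have hG : ∀ i, (0:ℝ) < gridSize m (k i) := fun i => by
      have : 0 < gridSize m (k i) := by unfold gridSize; positivity
      exact_mod_cast this
    refine ⟨_, _, ?_, ?_, ?_, rfl⟩
    · intro i _
      refine ⟨by positivity, ?_⟩
      rw [div_le_one (hG i)]
      exact_mod_cast Nat.lt_succ_iff.1 (hp i).1.1
    · intro i _
      refine ⟨by positivity, ?_⟩
      rw [div_le_one (hG i)]
      exact_mod_cast Nat.lt_succ_iff.1 (hp i).1.2
    · intro i h
      rw [div_left_inj' (hG i).ne'] at h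
      exact (hp i).2 (by exact_mod_cast h)
  · rintro B ⟨a, b, ha, hb, hab, rfl⟩ hv
    rw [vol_box] at hv ⊢
    have hpos : ∀ i, 0 < (volume (perInterval (a i) (b i))).toReal := by
      intro i
      refine lt_of_le_of_ne ENNReal.toReal_nonneg fun h => ?_
      rw [Finset.prod_eq_zero (Finset.mem_univ i) h.symm] at hv
      linarith
    choose k p hp hk hs hvol using fun i => coord_approx m hm (a i) (b i)
      (ha i (Set.mem_univ _)) (hb i (Set.mem_univ _)) (hab i) (hpos i)
    have hkprod : (∏ i, (2:ℝ)^(k i)) * ε ≤ 1 := by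
      calc _ ≤ (∏ i, (2:ℝ)^(k i)) * ∏ i, (volume (perInterval (a i) (b i))).toReal := by gcongr
        _ = ∏ i, ((2:ℝ)^(k i) * (volume (perInterval (a i) (b i))).toReal) :=
          Finset.prod_mul_distrib.symm
        _ ≤ 1 := Finset.prod_le_one (fun i _ => mul_nonneg (by positivity) (hpos i).le)
          fun i _ => hk i
    refine ⟨gridBox m k p, ?_, ?_, ?_⟩
    · simp only [netF, netK, Finset.mem_biUnion, Finset.mem_image, Fintype.mem_piFinset,
        Finset.mem_filter, Finset.mem_range]
      refine ⟨k, ⟨fun i => ?_, hkprod⟩, p, hp, rfl⟩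
      rw [Nat.lt_succ_iff]
      apply Nat.le_floor
      rw [le_div_iff₀ hε0]
      refine le_trans ?_ hkprod
      gcongr
      calc (k i : ℝ) ≤ 2^(k i) := by exact_mod_cast Nat.lt_two_pow_self.le
        _ ≤ _ := by
          rw [← Finset.mul_prod_erase _ _ (Finset.mem_univ i)]
          refine le_mul_of_one_le_right (by positivity) ?_
          exact Finset.prod_induction _ (fun x : ℝ => 1 ≤ x) (fun x y hx hy => one_le_mul_of_one_le_of_one_le hx hy) le_rfl
            fun j _ => one_le_pow₀ one_le_two
    · exact Set.pi_mono fun i _ => hs i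
    · unfold gridBox
      rw [vol_box]
      have h14 : 1/(2*(m:ℝ)) ≤ 1/4 := by
        apply one_div_le_one_div_of_le <;> linarith
      have hb : 1 - 1/2 ≤ (1 - 1/(2*(m:ℝ)))^m := by
        have := one_add_mul_le_pow (a := -(1/(2*(m:ℝ)))) (by linarith) m
        have e : (m:ℝ) * -(1/(2*(m:ℝ))) = -(1/2) := by field_simp
        rw [e] at this
        simpa [sub_eq_add_neg] using this
      calc _ ≤ (1 - 1/(2*(m:ℝ)))^m * ∏ i, (volume (perInterval (a i) (b i))).toReal := by
            gcongr
        _ = ∏ i, ((1 - 1/(2*(m:ℝ))) * (volume (perInterval (a i) (b i))).toReal) := by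
            rw [Finset.prod_mul_distrib]; simp
        _ ≤ _ := Finset.prod_le_prod
            (fun i _ => mul_nonneg (by linarith) (hpos i).le) fun i _ => hvol i

/-- For every integer `m ≥ 2` and `ε ∈ (0,1)` there exists a `(1/2)`-net for the family
`B̃_{ε,m}` of periodic boxes of volume at least `ε` of cardinality at most
`(14m)^{4m} / ε^{2 log₂(2m)}`. -/
theorem exists_half_net_periodic (m : ℕ) (hm : 2 ≤ m) (ε : ℝ) (hε0 : 0 < ε) (hε1 : ε < 1) :
    ∃ F : Finset (Set (Fin m → ℝ)), IsPerDeltaNet (1 / 2) ε m F ∧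
      (F.card : ℝ) ≤ (14 * (m : ℝ)) ^ (4 * m) / ε ^ (2 * Real.logb 2 (2 * (m : ℝ))) := by
  have hm' : (2:ℝ) ≤ m := by exact_mod_cast hm
  refine ⟨netF m ε, netF_net m hm ε hε0, (netF_card m hm ε hε0).trans ?_⟩
  have hlog : 2 ≤ Real.logb 2 (2 * (m:ℝ)) := by
    rw [Real.le_logb_iff_rpow_le one_lt_two (by linarith)]
    norm_num
    linarith
  have hpow : ε ^ (2 * Real.logb 2 (2 * (m : ℝ))) ≤ ε^3 := by
    rw [← Real.rpow_natCast]
    apply Real.rpow_le_rpow_of_exponent_ge hε0 hε1.le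
    push_cast
    linarith
  have hbase : (81 * (m:ℝ)^2 * 2)^m ≤ (14 * (m : ℝ)) ^ (4 * m) := by
    rw [pow_mul]
    gcongr
    have : (1:ℝ) ≤ (m:ℝ)^2 := by nlinarith
    nlinarith
  have := Real.rpow_pos_of_pos hε0 (2 * Real.logb 2 (2 * (m : ℝ)))
  gcongr
end
end

section
/- If m = 2^k for some positive integer k and ε ∈ (0,1), then there exists a (1/2)-net for B_{ε,m} of cardinality at most (24m)^{2m} / ε^{2·log₂ m}. -/
open MeasureTheory Set

noncomputable section

lemma oneDim (m : ℕ) (hm : 1 ≤ m) (a b : ℝ) (ha : 0 ≤ a) (hab : a < b) (hb : b ≤ 1) :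
    ∃ j p d : ℕ, (2:ℝ)^j * (b-a) ≤ 1 ∧ p < 9*m*2^j ∧ d < 9*m ∧
      a ≤ p/(8*m*2^j : ℝ) ∧ (p+d)/(8*m*2^j : ℝ) ≤ b ∧
      (1-1/(2*m : ℝ))*(b-a) ≤ (p+d)/(8*m*2^j : ℝ) - p/(8*m*2^j : ℝ) := by
  obtain ⟨j, h1, h2⟩ := exists_nat_pow_near_of_lt_one (x := b-a) (y := (1/2:ℝ))
    (by linarith) (by linarith) (by norm_num) (by norm_num)
  have hT : (1:ℝ) ≤ 2^j := one_le_pow₀ (by norm_num)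
  have hM : (1:ℝ) ≤ m := by exact_mod_cast hm
  have e1 : (1/2:ℝ)^j = 1/2^j := by rw [div_pow, one_pow]
  rw [pow_succ, e1] at h1
  rw [e1] at h2
  have hTp : (0:ℝ) < 2^j := by positivity
  have g2 : (2:ℝ)^j * (b-a) ≤ 1 := by
    rw [le_div_iff₀ hTp] at h2; linarith
  have g1 : 1 < 2 * ((2:ℝ)^j * (b-a)) := by
    rw [div_mul_div_comm, div_lt_iff₀ (by positivity)] at h1; linarith
  set N : ℝ := 8*m*2^j with hN
  have hNp : 0 < N := by positivity
  have hlN : (b-a)*N ≤ 8*m := by rw [hN]; nlinarith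
  have hlN' : 4*m ≤ (b-a)*N := by rw [hN]; nlinarith
  set p := ⌈a*N⌉₊ with hp
  set q := ⌊b*N⌋₊ with hq
  have p1 : a*N ≤ p := Nat.le_ceil _
  have p2 : (p:ℝ) < a*N+1 := Nat.ceil_lt_add_one (by positivity)
  have q1 : (q:ℝ) ≤ b*N := Nat.floor_le (by have : 0 < b := by linarith
                                            positivity)
  have q2 : b*N < q+1 := Nat.lt_floor_add_one _
  have hpq : p ≤ q := by
    have : (p:ℝ) ≤ q := by nlinarith
    exact_mod_cast this
  have hd : ((q - p : ℕ):ℝ) = q - p := by rw [Nat.cast_sub hpq]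
  refine ⟨j, p, q-p, g2, ?_, ?_, ?_, ?_, ?_⟩
  · have : (p:ℝ) < ((9*m*2^j : ℕ):ℝ) := by
      push_cast
      have : a*N ≤ N := by nlinarith
      have : 1 ≤ (m:ℝ)*2^j := by nlinarith
      have : (p:ℝ) ≤ q := by exact_mod_cast hpq
      have : b*N ≤ N := by nlinarith
      linarith
    exact_mod_cast this
  · have : ((q-p:ℕ):ℝ) < ((9*m : ℕ):ℝ) := by
      rw [hd]; push_cast
      nlinarith
    exact_mod_cast this
  · rw [le_div_iff₀ hNp]; exact p1
  · rw [div_le_iff₀ hNp, hd]; linarith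
  · rw [← sub_div, le_div_iff₀ hNp, hd]
    have : (1-1/(2*m : ℝ))*(b-a)*N = (b-a)*N - ((b-a)*N)/(2*m) := by ring
    rw [this]
    have : 2 ≤ ((b-a)*N)/(2*m) := by rw [le_div_iff₀ (by positivity)]; linarith
    linarith

lemma geom_half_le (M : ℕ) : ∑ x ∈ Finset.range M, (1/2:ℝ)^x ≤ 2 := by
  have := geom_sum_eq (x := (1/2:ℝ)) (by norm_num) M
  rw [this]
  have : (0:ℝ) < (1/2)^M := by positivity
  rw [div_le_iff_of_neg (by norm_num)]
  linarith

/-- If `m = 2^k` for some positive integer `k` and `ε ∈ (0,1)`, then there exists a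
`(1/2)`-net for `B_{ε,m}` of cardinality at most `(24m)^{2m} / ε^{2 log₂ m}`. -/
theorem exists_half_net_pow_two (m k : ℕ) (hk : 1 ≤ k) (hm : m = 2 ^ k)
    (ε : ℝ) (hε0 : 0 < ε) (hε1 : ε < 1) :
    ∃ F : Finset (Set (Fin m → ℝ)), IsDeltaNet (1 / 2) ε m F ∧
      (F.card : ℝ) ≤ (24 * (m : ℝ)) ^ (2 * m) / ε ^ (2 * Real.logb 2 (m : ℝ)) := by
  classical
  have hm1 : 1 ≤ m := by rw [hm]; exact Nat.one_le_two_pow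
  have hM : (1:ℝ) ≤ m := by exact_mod_cast hm1
  obtain ⟨M, hMe⟩ := pow_unbounded_of_one_lt (1/ε) (by norm_num : (1:ℝ) < 2)
  let J : Finset (Fin m → ℕ) := (Fintype.piFinset fun _ => Finset.range M).filter
    (fun j => (2:ℝ)^(∑ i, j i) * ε ≤ 1)
  let box : (Fin m → ℕ) → (Fin m → ℕ × ℕ) → Set (Fin m → ℝ) := fun j c =>
    Set.univ.pi fun i => Set.Ico ((c i).1/(8*m*2^(j i) : ℝ))
      (((c i).1 + (c i).2)/(8*m*2^(j i) : ℝ))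
  let C : (Fin m → ℕ) → Finset (Fin m → ℕ × ℕ) := fun j =>
    Fintype.piFinset fun i => Finset.range (9*m*2^(j i)) ×ˢ Finset.range (9*m)
  let F0 : Finset (Set (Fin m → ℝ)) := J.biUnion fun j => (C j).image (box j)
  refine ⟨F0.filter IsBox, ⟨fun B hB => (Finset.mem_filter.1 hB).2, ?_⟩, ?_⟩
  · rintro B ⟨a, b, hab, rfl⟩ hv
    have hle : a ≤ b := fun i => (hab i).2.1
    rw [Real.volume_pi_Ico_toReal hle] at hv ⊢
    have hlt : ∀ i, a i < b i := by
      intro i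
      refine lt_of_le_of_ne (hle i) fun h => ?_
      have : ∏ i, (b i - a i) = 0 := Finset.prod_eq_zero (Finset.mem_univ i) (by rw [h, sub_self])
      linarith
    choose j p d h1 h2 h3 h4 h5 h6 using
      fun i => oneDim m hm1 (a i) (b i) (hab i).1 (hlt i) (hab i).2.2
    have hsum : (2:ℝ)^(∑ i, j i) * ε ≤ 1 := by
      calc (2:ℝ)^(∑ i, j i) * ε ≤ (2:ℝ)^(∑ i, j i) * ∏ i, (b i - a i) := by gcongr
        _ = ∏ i, ((2:ℝ)^(j i) * (b i - a i)) := by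
          rw [Finset.prod_mul_distrib, Finset.prod_pow_eq_pow_sum]
        _ ≤ 1 := Finset.prod_le_one
          (fun i _ => mul_nonneg (by positivity) (by linarith [hlt i])) (fun i _ => h1 i)
    have hjM : ∀ i, j i < M := by
      intro i
      have s1 : j i ≤ ∑ i, j i := Finset.single_le_sum (fun _ _ => Nat.zero_le _) (Finset.mem_univ i)
      have s2 : (2:ℝ)^(∑ i, j i) < 2^M := lt_of_le_of_lt ((le_div_iff₀ hε0).2 hsum) hMe
      exact lt_of_le_of_lt s1 ((pow_lt_pow_iff_right₀ (by norm_num)).1 s2)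
    have hle' : (fun i => (p i:ℝ)/(8*m*2^(j i) : ℝ)) ≤
        (fun i => ((p i:ℝ) + d i)/(8*m*2^(j i) : ℝ)) := by
      intro i
      dsimp only
      gcongr
      linarith [Nat.cast_nonneg (α := ℝ) (d i)]
    refine ⟨box j (fun i => (p i, d i)), ?_, ?_, ?_⟩
    · refine Finset.mem_filter.2 ⟨Finset.mem_biUnion.2 ⟨j, ?_, Finset.mem_image_of_mem _ ?_⟩, ?_⟩
      · simp only [J, Finset.mem_filter, Fintype.mem_piFinset, Finset.mem_range]
        exact ⟨hjM, hsum⟩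
      · simp only [C, Fintype.mem_piFinset, Finset.mem_product, Finset.mem_range]
        exact fun i => ⟨h2 i, h3 i⟩
      · exact ⟨_, _, fun i => ⟨by positivity, hle' i, (h5 i).trans (hab i).2.2⟩, rfl⟩
    · exact Set.pi_mono fun i _ => Set.Ico_subset_Ico (h4 i) (h5 i)
    · have hpos : (0:ℝ) ≤ 1-1/(2*m) := by
        rw [sub_nonneg, div_le_one (by positivity)]; linarith
      rw [Real.volume_pi_Ico_toReal hle']
      calc (1-1/2) * ∏ i, (b i - a i) ≤ (1-1/(2*m:ℝ))^m * ∏ i, (b i - a i) := by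
            gcongr
            · exact Finset.prod_nonneg fun i _ => by linarith [hlt i]
            · have := one_add_mul_le_pow (a := -(1/(2*m:ℝ))) (by linarith) m
              have e : (m:ℝ) * (-(1/(2*m:ℝ))) = -(1/2) := by field_simp
              rw [e] at this
              simpa [sub_eq_add_neg] using this
        _ = ∏ i, ((1-1/(2*m:ℝ)) * (b i - a i)) := by
            rw [Finset.prod_mul_distrib]; simp
        _ ≤ _ := Finset.prod_le_prod
            (fun i _ => mul_nonneg hpos (by linarith [hlt i])) (fun i _ => h6 i)
  · have hlog : Real.logb 2 (m:ℝ) = k := by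
      rw [hm]; push_cast
      rw [Real.logb_pow, Real.logb_self_eq_one (by norm_num), mul_one]
    have hcard : ∀ j ∈ J, (((C j).image (box j)).card : ℝ) ≤
        (9*m:ℝ)^(2*m) / ε^2 * ∏ i, (1/2:ℝ)^(j i) := by
      intro j hj
      have hs := (Finset.mem_filter.1 hj).2
      have : (((C j).card : ℕ):ℝ) = (9*m:ℝ)^(2*m) * 2^(∑ i, j i) := by
        simp only [C, Fintype.card_piFinset, Finset.card_product, Finset.card_range]
        push_cast
        rw [← Finset.prod_pow_eq_pow_sum, Finset.prod_mul_distrib, Finset.prod_mul_distrib]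
        simp
        ring
      refine (Nat.cast_le.2 Finset.card_image_le).trans ?_
      rw [this, Finset.prod_pow_eq_pow_sum, div_mul_eq_mul_div, mul_div_assoc]
      gcongr
      rw [le_div_iff₀ (by positivity), one_div, inv_pow, inv_eq_one_div,
        le_div_iff₀ (by positivity)]
      have : (0:ℝ) ≤ (2:ℝ)^(∑ i, j i) * ε := by positivity
      nlinarith
    have hF : ((F0.filter IsBox).card : ℝ) ≤ (9*m:ℝ)^(2*m) / ε^2 * 2^m := by
      calc ((F0.filter IsBox).card : ℝ) ≤ F0.card := by exact_mod_cast Finset.card_filter_le _ _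
        _ ≤ ∑ j ∈ J, (((C j).image (box j)).card : ℝ) := by exact_mod_cast Finset.card_biUnion_le
        _ ≤ ∑ j ∈ J, (9*m:ℝ)^(2*m) / ε^2 * ∏ i, (1/2:ℝ)^(j i) := Finset.sum_le_sum hcard
        _ = (9*m:ℝ)^(2*m) / ε^2 * ∑ j ∈ J, ∏ i, (1/2:ℝ)^(j i) := by rw [Finset.mul_sum]
        _ ≤ (9*m:ℝ)^(2*m) / ε^2 * ∑ j ∈ Fintype.piFinset fun _ : Fin m => Finset.range M,
              ∏ i, (1/2:ℝ)^(j i) := by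
            gcongr
            exact Finset.filter_subset _ _
        _ = (9*m:ℝ)^(2*m) / ε^2 * ∏ i : Fin m, ∑ x ∈ Finset.range M, (1/2:ℝ)^x := by
            rw [Finset.prod_univ_sum]
        _ ≤ (9*m:ℝ)^(2*m) / ε^2 * 2^m := by
            gcongr
            calc ∏ i : Fin m, ∑ x ∈ Finset.range M, (1/2:ℝ)^x ≤ ∏ i : Fin m, (2:ℝ) :=
                  Finset.prod_le_prod (fun _ _ => by positivity) (fun _ _ => geom_half_le M)
              _ = 2^m := by simp
    refine hF.trans ?_
    have e : ε ^ (2 * Real.logb 2 (m:ℝ)) = ε^(2*k) := by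
      rw [hlog, ← Real.rpow_natCast]; push_cast; rfl
    rw [e, div_mul_eq_mul_div]
    have hp : ε^(2*k) ≤ ε^2 := pow_le_pow_of_le_one hε0.le hε1.le (by omega)
    have hq : (9*m:ℝ)^(2*m) * 2^m ≤ (24*m:ℝ)^(2*m) := by
      rw [pow_mul, pow_mul, ← mul_pow]
      gcongr
      nlinarith
    gcongr
end
end
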